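/- arXiv:1004.3867 — 5 statements merged into one kernel-verified Lean document; each statement's English description precedes it below -/
import Mathlib

section
/- Fix τ < δ and a point (x₀, y₀) with x₀ < 0. Let (x_a, y_a) be the solution of the attractive reduced system with x_a(τ) = x₀, y_a(τ) = y₀, and assume x_a(t) < 0 for all τ ≤ t ≤ δ. For each ε > 0 let (x_ε, y_ε, z_ε) be the solution of the slow–fast system with x_ε(τ) = x₀, y_ε(τ) = y₀, z_ε(τ) = 0. Then for every sufficiently small ε > 0, z_ε(t) < 0 for all t with τ < t ≤ δ. -/
/-- A negative derivative forces a strict local decrease. -/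
lemma aux_neg_deriv (Z : ℝ → ℝ) (d T : ℝ) (h : HasDerivAt Z d T) (hd : d < 0) :
    ∃ η > 0, (∀ s, T - η < s → s < T → Z T < Z s) ∧ (∀ s, T < s → s < T + η → Z s < Z T) := by
  rw [hasDerivAt_iff_tendsto_slope] at h
  have h1 := h.eventually (gt_mem_nhds hd)
  rw [eventually_nhdsWithin_iff, Metric.eventually_nhds_iff] at h1
  obtain ⟨η, hη, h1⟩ := h1
  refine ⟨η, hη, fun s hs1 hs2 => ?_, fun s hs1 hs2 => ?_⟩
  · have := h1 (y := s) (by rw [Real.dist_eq, abs_lt]; constructor <;> linarith) (by simp; linarith)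
    rw [slope_def_field, div_neg_iff] at this
    rcases this with h | h <;> linarith
  · have := h1 (y := s) (by rw [Real.dist_eq, abs_lt]; constructor <;> linarith) (by simp; linarith)
    rw [slope_def_field, div_neg_iff] at this
    rcases this with h | h <;> linarith

/-- Existence of a first return to zero. -/
lemma aux_first (Z : ℝ → ℝ) (hc : Continuous Z) (τ η t1 : ℝ) (hη : 0 < η)
    (hneg : ∀ s, τ < s → s < τ + η → Z s < 0) (ht1 : τ < t1) (h1 : 0 ≤ Z t1) :
    ∃ T, τ < T ∧ T ≤ t1 ∧ Z T = 0 ∧ ∀ s, τ < s → s < T → Z s < 0 := by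
  have hlt : τ + η ≤ t1 := by
    by_contra hh
    have := hneg t1 ht1 (by linarith)
    linarith
  have hcomp : IsCompact (Set.Icc (τ + η / 2) t1 ∩ {t | 0 ≤ Z t}) :=
    isCompact_Icc.inter_right (isClosed_le continuous_const hc)
  obtain ⟨T, ⟨⟨hT1, hT2⟩, hT3⟩, hleast⟩ := hcomp.exists_isLeast
    ⟨t1, ⟨⟨by linarith, le_refl _⟩, h1⟩⟩
  have hlow : ∀ s, τ < s → s < T → Z s < 0 := by
    intro s hs1 hs2
    by_contra hh
    rcases lt_or_ge s (τ + η / 2) with h | h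
    · exact hh (hneg s hs1 (by linarith))
    · have := hleast ⟨⟨h, by linarith⟩, (not_lt.mp hh : 0 ≤ Z s)⟩
      linarith
  have hτT : τ < T := by linarith
  refine ⟨T, hτT, hT2, le_antisymm ?_ hT3, hlow⟩
  have ht : Filter.Tendsto Z (nhdsWithin T (Set.Iio T)) (nhds (Z T)) :=
    (hc.tendsto T).mono_left nhdsWithin_le_nhds
  refine le_of_tendsto ht ?_
  filter_upwards [Ioo_mem_nhdsLT hτT] with s hs
  exact (hlow s hs.1 hs.2).le

/-- The pointwise Lyapunov inequality. -/
lemma aux_ineq (a b w F G p q ε lam M : ℝ) (hε : 0 < ε) (hlam : 0 ≤ lam)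
    (hp : |p| ≤ lam * (|a| + |b| + (|a| + |w|))) (hq : |q| ≤ lam * (|a| + |b| + (|a| + |w|)))
    (hF : |F| < M) :
    2 * a * p + 2 * b * q + lam * ε * (2 * w * (-w / ε - F))
      ≤ 10 * lam * (a ^ 2 + b ^ 2 + lam * ε * w ^ 2) + lam * ε ^ 2 * M ^ 2 := by
  have e1 : lam * ε * (2 * w * (-w / ε - F)) = lam * (-2 * w ^ 2 - 2 * (w * (ε * F))) := by
    field_simp
  rw [e1]
  have hF2 : F ^ 2 ≤ M ^ 2 := sq_le_sq' (by linarith [(abs_lt.mp hF).1]) (abs_lt.mp hF).2.le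
  have e2 : -2 * w ^ 2 - 2 * (w * (ε * F)) ≤ - w ^ 2 + ε ^ 2 * M ^ 2 := by
    nlinarith [sq_nonneg (w + ε * F), mul_le_mul_of_nonneg_left hF2 (sq_nonneg ε)]
  have e3 := mul_le_mul_of_nonneg_left e2 hlam
  have a1 : a * p ≤ |a| * (lam * (|a| + |b| + (|a| + |w|))) :=
    (le_abs_self _).trans (by rw [abs_mul]; exact mul_le_mul_of_nonneg_left hp (abs_nonneg _))
  have b1 : b * q ≤ |b| * (lam * (|a| + |b| + (|a| + |w|))) :=
    (le_abs_self _).trans (by rw [abs_mul]; exact mul_le_mul_of_nonneg_left hq (abs_nonneg _))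
  have e4 : 2 * (|a| + |b|) * (|a| + |b| + (|a| + |w|)) ≤ 10 * (a ^ 2 + b ^ 2) + w ^ 2 := by
    rw [← sq_abs a, ← sq_abs b, ← sq_abs w]
    nlinarith [sq_nonneg (|a| - |b|), sq_nonneg (|a| + |b| - |w|), abs_nonneg a, abs_nonneg b,
      mul_nonneg (abs_nonneg a) (abs_nonneg b), sq_nonneg (|b|)]
  have e5 := mul_le_mul_of_nonneg_left e4 hlam
  have e6 : 0 ≤ lam * (lam * ε * w ^ 2) := by positivity
  nlinarith

/-- (Stabilizing initial points.) If the attractive reduced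
solution starting at `(x₀, y₀)` (with `x₀ < 0`) at time `τ` satisfies
`x_a(t) < 0` for all `τ ≤ t ≤ δ`, then for every sufficiently small `ε > 0` the
fast component of the corresponding solution of the slow–fast system satisfies
`z_ε(t) < 0` for all `τ < t ≤ δ`. -/
theorem stabilizing_z_stays_negative
    (M lam τ δ x₀ y₀ : ℝ) (hM : 0 < M) (hlam : 0 ≤ lam)
    (hτδ : τ < δ) (hx₀ : x₀ < 0)
    (f g : ℝ → ℝ → ℝ → ℝ)
    -- Assumption 1: global boundedness and global Lipschitz continuity
    (hbound : ∀ x y z : ℝ, |f x y z| < M ∧ |g x y z| < M)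
    (hLipf : ∀ x₁ y₁ z₁ x₂ y₂ z₂ : ℝ,
      |f x₁ y₁ z₁ - f x₂ y₂ z₂| ≤ lam * (|x₁ - x₂| + |y₁ - y₂| + |z₁ - z₂|))
    (hLipg : ∀ x₁ y₁ z₁ x₂ y₂ z₂ : ℝ,
      |g x₁ y₁ z₁ - g x₂ y₂ z₂| ≤ lam * (|x₁ - x₂| + |y₁ - y₂| + |z₁ - z₂|))
    -- (x_a, y_a) is the solution of the attractive reduced system
    (xa ya : ℝ → ℝ)
    (hxa : ∀ t : ℝ, HasDerivAt xa (f (xa t) (ya t) (xa t)) t)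
    (hya : ∀ t : ℝ, HasDerivAt ya (g (xa t) (ya t) (xa t)) t)
    (hxaτ : xa τ = x₀) (hyaτ : ya τ = y₀)
    (hxaneg : ∀ t : ℝ, τ ≤ t → t ≤ δ → xa t < 0)
    -- for each ε > 0, (X ε, Y ε, Z ε) is the solution of the slow–fast system
    (X Y Z : ℝ → ℝ → ℝ)
    (hX : ∀ ε : ℝ, 0 < ε → ∀ t : ℝ,
      HasDerivAt (X ε) (f (X ε t) (Y ε t) (Z ε t)) t)
    (hY : ∀ ε : ℝ, 0 < ε → ∀ t : ℝ,
      HasDerivAt (Y ε) (g (X ε t) (Y ε t) (Z ε t)) t)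
    (hZ : ∀ ε : ℝ, 0 < ε → ∀ t : ℝ,
      HasDerivAt (Z ε) ((X ε t + |Z ε t|) / ε) t)
    (hIC : ∀ ε : ℝ, 0 < ε → X ε τ = x₀ ∧ Y ε τ = y₀ ∧ Z ε τ = 0) :
    ∃ ε₀ > (0 : ℝ), ∀ ε : ℝ, 0 < ε → ε < ε₀ →
      ∀ t : ℝ, τ < t → t ≤ δ → Z ε t < 0 := by
  obtain ⟨t₀, ht₀, hmax⟩ := isCompact_Icc.exists_isMaxOn (Set.nonempty_Icc.mpr hτδ.le)
    (f := xa) (fun t _ => (hxa t).continuousAt.continuousWithinAt)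
  have hc : xa t₀ < 0 := hxaneg t₀ ht₀.1 ht₀.2
  set c := xa t₀ with hcdef
  set B : ℝ := (lam * x₀ ^ 2 + M ^ 2) * Real.exp (10 * lam * (δ - τ)) with hB
  have hBpos : 0 < B := by positivity
  refine ⟨min 1 (c ^ 2 / B), lt_min one_pos (div_pos (by nlinarith) hBpos), ?_⟩
  intro ε hε hε0 t1 ht1 ht1δ
  have hε1 : ε < 1 := lt_of_lt_of_le hε0 (min_le_left _ _)
  have hεB : ε * B < c ^ 2 := (lt_div_iff₀ hBpos).mp (lt_of_lt_of_le hε0 (min_le_right _ _))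
  obtain ⟨iX, iY, iZ⟩ := hIC ε hε
  by_contra hcon
  have hcZ : Continuous (Z ε) :=
    continuous_iff_continuousAt.mpr fun t => (hZ ε hε t).continuousAt
  obtain ⟨η, hη, -, hη2⟩ := aux_neg_deriv (Z ε) _ τ (hZ ε hε τ)
    (by rw [iX, iZ]; simpa using div_neg_of_neg_of_pos hx₀ hε)
  rw [iZ] at hη2
  obtain ⟨T, hτT, hTt1, hZT, hlow⟩ := aux_first (Z ε) hcZ τ η t1 hη hη2 ht1 (not_lt.mp hcon)
  -- the Lyapunov function
  let V : ℝ → ℝ := fun t => (X ε t - xa t) ^ 2 + (Y ε t - ya t) ^ 2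
    + lam * ε * (Z ε t - X ε t) ^ 2
  let V' : ℝ → ℝ := fun t =>
    2 * (X ε t - xa t) * (f (X ε t) (Y ε t) (Z ε t) - f (xa t) (ya t) (xa t))
    + 2 * (Y ε t - ya t) * (g (X ε t) (Y ε t) (Z ε t) - g (xa t) (ya t) (xa t))
    + lam * ε * (2 * (Z ε t - X ε t) * ((X ε t + |Z ε t|) / ε - f (X ε t) (Y ε t) (Z ε t)))
  have hV : ∀ t, HasDerivAt V (V' t) t := by
    intro t
    have h := ((((hX ε hε t).sub (hxa t)).pow 2).add (((hY ε hε t).sub (hya t)).pow 2)).add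
      ((((hZ ε hε t).sub (hX ε hε t)).pow 2).const_mul (lam * ε))
    refine h.congr_deriv ?_
    simp [V']
  let U : ℝ → ℝ := fun t => (V t + ε ^ 2 * M ^ 2 / 10) * Real.exp (-(10 * lam) * (t - τ))
  have hU : ∀ t, HasDerivAt U (V' t * Real.exp (-(10 * lam) * (t - τ)) +
      (V t + ε ^ 2 * M ^ 2 / 10) * (Real.exp (-(10 * lam) * (t - τ)) * (-(10 * lam)))) t := by
    intro t
    have he : HasDerivAt (fun t : ℝ => -(10 * lam) * (t - τ)) (-(10 * lam)) t := by
      simpa using ((hasDerivAt_id t).sub_const τ).const_mul (-(10 * lam))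
    exact ((hV t).add_const _).mul he.exp
  have hanti : AntitoneOn U (Set.Icc τ T) := by
    refine antitoneOn_of_deriv_nonpos (convex_Icc τ T)
      (fun t _ => (hU t).continuousAt.continuousWithinAt)
      (fun t _ => (hU t).differentiableAt.differentiableWithinAt) ?_
    intro t ht
    rw [interior_Icc] at ht
    rw [(hU t).deriv]
    have hZneg := hlow t ht.1 ht.2
    have htri : |Z ε t - xa t| ≤ |X ε t - xa t| + |Z ε t - X ε t| := by
      have := abs_add_le (X ε t - xa t) (Z ε t - X ε t)
      rwa [show X ε t - xa t + (Z ε t - X ε t) = Z ε t - xa t by ring] at this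
    have hkey := aux_ineq (X ε t - xa t) (Y ε t - ya t) (Z ε t - X ε t)
      (f (X ε t) (Y ε t) (Z ε t)) 0
      (f (X ε t) (Y ε t) (Z ε t) - f (xa t) (ya t) (xa t))
      (g (X ε t) (Y ε t) (Z ε t) - g (xa t) (ya t) (xa t)) ε lam M hε hlam
      ((hLipf _ _ _ _ _ _).trans (mul_le_mul_of_nonneg_left (by linarith) hlam))
      ((hLipg _ _ _ _ _ _).trans (mul_le_mul_of_nonneg_left (by linarith) hlam))
      (hbound _ _ _).1
    have hV'le : V' t ≤ 10 * lam * V t + lam * ε ^ 2 * M ^ 2 := by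
      have e : X ε t + |Z ε t| = -(Z ε t - X ε t) := by rw [abs_of_neg hZneg]; ring
      simp only [V', V]
      rw [e]
      exact hkey
    have hexp := Real.exp_pos (-(10 * lam) * (t - τ))
    have : (V' t - (10 * lam * V t + lam * ε ^ 2 * M ^ 2)) *
        Real.exp (-(10 * lam) * (t - τ)) ≤ 0 :=
      mul_nonpos_of_nonpos_of_nonneg (by linarith) hexp.le
    linarith
  have hUT := hanti (Set.left_mem_Icc.mpr hτT.le) (Set.right_mem_Icc.mpr hτT.le) hτT.le
  have hUτ : U τ = lam * ε * x₀ ^ 2 + ε ^ 2 * M ^ 2 / 10 := by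
    simp [U, V, iX, iY, iZ, hxaτ, hyaτ]
  have hVT : V T ≤ ε * B := by
    have h1 : V T + ε ^ 2 * M ^ 2 / 10 = U T * Real.exp (10 * lam * (T - τ)) := by
      simp only [U]
      rw [mul_assoc, ← Real.exp_add]
      simp
    have h2 : U T * Real.exp (10 * lam * (T - τ)) ≤
        (ε * (lam * x₀ ^ 2 + M ^ 2)) * Real.exp (10 * lam * (δ - τ)) := by
      apply mul_le_mul
      · rw [hUτ] at hUT
        have : ε ^ 2 * M ^ 2 ≤ ε * M ^ 2 :=
          mul_le_mul_of_nonneg_right (by nlinarith) (sq_nonneg M)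
        have : 0 ≤ ε * M ^ 2 := by positivity
        linarith
      · apply Real.exp_le_exp.mpr
        apply mul_le_mul_of_nonneg_left _ (by positivity)
        linarith
      · positivity
      · positivity
    have h3 : 0 ≤ ε ^ 2 * M ^ 2 / 10 := by positivity
    rw [hB, ← mul_assoc]
    linarith
  have hsq : (X ε T - xa T) ^ 2 < c ^ 2 := by
    have h1 : 0 ≤ (Y ε T - ya T) ^ 2 := sq_nonneg _
    have h2 : 0 ≤ lam * ε * (Z ε T - X ε T) ^ 2 := by positivity
    have h3 : V T = (X ε T - xa T) ^ 2 + (Y ε T - ya T) ^ 2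
      + lam * ε * (Z ε T - X ε T) ^ 2 := rfl
    linarith
  have habs := abs_lt_of_sq_lt_sq (a := X ε T - xa T) (b := -c) (by rwa [neg_sq]) (by linarith)
  have hxaT : xa T ≤ c := hmax (show T ∈ Set.Icc τ δ from ⟨hτT.le, hTt1.trans ht1δ⟩)
  have hXT : X ε T < 0 := by linarith [(abs_lt.mp habs).2]
  obtain ⟨η', hη', hl, -⟩ := aux_neg_deriv (Z ε) _ T (hZ ε hε T)
    (by rw [hZT]; simpa using div_neg_of_neg_of_pos hXT hε)
  have hm1 : max τ (T - η') < T := max_lt hτT (by linarith)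
  obtain ⟨s, hs1, hs2⟩ := exists_between hm1
  have := hl s (lt_of_le_of_lt (le_max_right _ _) hs1) hs2
  have := hlow s (lt_of_le_of_lt (le_max_left _ _) hs1) hs2
  linarith
end

section
/- Let (x, y, z) be a solution of the slow–fast system on an interval [τ, T] with x(τ) < 0 and z(τ) = 0. Suppose t̂ ∈ (τ, T) satisfies z(t) < 0 for all t ∈ (τ, t̂) and z(t̂) = 0, and suppose there exists s ∈ (t̂, T] with z(s) ≤ 0. Then 0 ≤ x(t̂) ≤ Mε. -/
/-- Let `(x, y, z)` be a solution of the slow–fast system on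
`[τ, T]` with `x(τ) < 0` and `z(τ) = 0`. If `t̂ ∈ (τ, T)` satisfies `z < 0` on
`(τ, t̂)`, `z(t̂) = 0`, and `z(s) ≤ 0` for some `s ∈ (t̂, T]`, then
`0 ≤ x(t̂) ≤ Mε`. -/
theorem x_small_at_first_zero
    (M lam ε τ T th : ℝ) (hM : 0 < M) (hlam : 0 ≤ lam) (hε : 0 < ε)
    (f g : ℝ → ℝ → ℝ → ℝ)
    -- Assumption 1: global boundedness and global Lipschitz continuity
    (hbound : ∀ x y z : ℝ, |f x y z| < M ∧ |g x y z| < M)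
    (hLipf : ∀ x₁ y₁ z₁ x₂ y₂ z₂ : ℝ,
      |f x₁ y₁ z₁ - f x₂ y₂ z₂| ≤ lam * (|x₁ - x₂| + |y₁ - y₂| + |z₁ - z₂|))
    (hLipg : ∀ x₁ y₁ z₁ x₂ y₂ z₂ : ℝ,
      |g x₁ y₁ z₁ - g x₂ y₂ z₂| ≤ lam * (|x₁ - x₂| + |y₁ - y₂| + |z₁ - z₂|))
    -- (x, y, z) is a solution of the slow–fast system on [τ, T]
    (x y z : ℝ → ℝ)
    (hx : ∀ t ∈ Set.Icc τ T, HasDerivAt x (f (x t) (y t) (z t)) t)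
    (hy : ∀ t ∈ Set.Icc τ T, HasDerivAt y (g (x t) (y t) (z t)) t)
    (hz : ∀ t ∈ Set.Icc τ T, HasDerivAt z ((x t + |z t|) / ε) t)
    -- initial conditions
    (hxτ : x τ < 0) (hzτ : z τ = 0)
    -- the first zero t̂ of z in (τ, T)
    (hth : th ∈ Set.Ioo τ T)
    (hzneg : ∀ t : ℝ, τ < t → t < th → z t < 0)
    (hzth : z th = 0)
    -- z returns to the half-space z ≤ 0 at some later time s
    (hs : ∃ s : ℝ, th < s ∧ s ≤ T ∧ z s ≤ 0) :
    0 ≤ x th ∧ x th ≤ M * ε := by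
  obtain ⟨hτ, hT⟩ := hth
  have hthI : th ∈ Set.Icc τ T := ⟨hτ.le, hT.le⟩
  constructor
  · have h1 := (hz th hthI).hasDerivWithinAt (s := Set.Iio th)
    rw [hasDerivWithinAt_iff_tendsto_slope' (by simp)] at h1
    have h2 : 0 ≤ (x th + |z th|) / ε := by
      refine ge_of_tendsto h1 ?_
      filter_upwards [Ioo_mem_nhdsLT hτ] with t ht
      rw [slope_def_field, hzth]
      have := hzneg t ht.1 ht.2
      apply div_nonneg_of_nonpos <;> linarith [ht.2]
    rw [hzth, abs_zero, add_zero] at h2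
    by_contra hneg
    push Not at hneg
    exact absurd h2 (not_le.mpr (div_neg_of_neg_of_pos hneg hε))
  · by_contra hgt
    push Not at hgt
    obtain ⟨s, hs1, hs2, hs3⟩ := hs
    have hsub : ∀ t ∈ Set.Icc th s, t ∈ Set.Icc τ T := fun t ht =>
      ⟨hτ.le.trans ht.1, ht.2.trans hs2⟩
    have hd : ∀ t ∈ Set.Icc th s, HasDerivAt (fun t => (x t + z t - M * ε) * Real.exp (-t / ε))
        ((f (x t) (y t) (z t) + (x t + |z t|) / ε) * Real.exp (-t / ε)
          + (x t + z t - M * ε) * (Real.exp (-t / ε) * (-1 / ε))) t := by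
      intro t ht
      exact (((hx t (hsub t ht)).add (hz t (hsub t ht))).sub_const (M * ε)).mul
        (((hasDerivAt_id t).neg.div_const ε).exp)
    have hmono : MonotoneOn (fun t => (x t + z t - M * ε) * Real.exp (-t / ε))
        (Set.Icc th s) := by
      refine monotoneOn_of_deriv_nonneg (convex_Icc _ _)
        (fun t ht => (hd t ht).continuousAt.continuousWithinAt)
        (fun t ht => (hd t (interior_subset ht)).differentiableAt.differentiableWithinAt) ?_
      intro t ht
      rw [(hd t (interior_subset ht)).deriv]
      have hf := (abs_lt.mp (hbound (x t) (y t) (z t)).1).1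
      have e : (f (x t) (y t) (z t) + (x t + |z t|) / ε) * Real.exp (-t / ε)
          + (x t + z t - M * ε) * (Real.exp (-t / ε) * (-1 / ε))
          = ((f (x t) (y t) (z t) + M) + (|z t| - z t) / ε) * Real.exp (-t / ε) := by
        field_simp
        ring
      rw [e]
      have h3 : 0 ≤ (|z t| - z t) / ε := div_nonneg (by linarith [le_abs_self (z t)]) hε.le
      exact mul_nonneg (by linarith) (Real.exp_pos _).le
    have hpos : ∀ t ∈ Set.Icc th s, 0 < x t + z t - M * ε := by
      intro t ht
      have h4 := hmono (Set.left_mem_Icc.mpr hs1.le) ht ht.1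
      simp only [hzth] at h4
      have h5 : 0 < (x th + 0 - M * ε) * Real.exp (-th / ε) :=
        mul_pos (by linarith) (Real.exp_pos _)
      exact pos_of_mul_pos_left (h5.trans_le h4) (Real.exp_pos _).le
    have hz2 : StrictMonoOn z (Set.Icc th s) := by
      refine strictMonoOn_of_deriv_pos (convex_Icc _ _)
        (fun t ht => (hz t (hsub t ht)).continuousAt.continuousWithinAt) ?_
      intro t ht
      have ht' := interior_subset ht
      rw [(hz t (hsub t ht')).deriv]
      have := hpos t ht'
      have := mul_pos hM hε
      exact div_pos (by linarith [le_abs_self (z t)]) hε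
    have := hz2 (Set.left_mem_Icc.mpr hs1.le) (Set.right_mem_Icc.mpr hs1.le) hs1
    linarith
end

section
/- In the setting described in the context, for every sufficiently small ε > 0 (among those ε for which the stated hypotheses hold) one has |t̂_ε − t̃| ≤ ρ/4 and 0 ≤ x_ε(t̂_ε) ≤ Mε; moreover y_ε(t̂_ε) → 0 as ε → 0 along such ε. -/
open Set Filter Topology

theorem aux_mono {u u' : ℝ → ℝ} {a b : ℝ} (hab : a ≤ b)
    (hu : ∀ t, HasDerivAt u (u' t) t) (h : ∀ t ∈ Ioo a b, 0 ≤ u' t) : u a ≤ u b := by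
  rcases hab.eq_or_lt with rfl | hlt
  · exact le_rfl
  · obtain ⟨c, hc, he⟩ := exists_hasDerivAt_eq_slope u u' hlt
      (fun t _ => (hu t).continuousAt.continuousWithinAt) (fun t _ => hu t)
    have h1 := h c hc
    rw [he] at h1
    have h2 : 0 < b - a := by linarith
    have h3 := mul_nonneg h1 h2.le
    rw [div_mul_cancel₀ _ h2.ne'] at h3
    linarith

theorem aux_strictmono {u u' : ℝ → ℝ} {a b : ℝ} (hlt : a < b)
    (hu : ∀ t, HasDerivAt u (u' t) t) (h : ∀ t ∈ Ioo a b, 0 < u' t) : u a < u b := by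
  obtain ⟨c, hc, he⟩ := exists_hasDerivAt_eq_slope u u' hlt
      (fun t _ => (hu t).continuousAt.continuousWithinAt) (fun t _ => hu t)
  have h1 := h c hc
  rw [he] at h1
  have h2 : 0 < b - a := by linarith
  have h3 := mul_pos h1 h2
  rw [div_mul_cancel₀ _ h2.ne'] at h3
  linarith

theorem aux_lip {u u' : ℝ → ℝ} {M : ℝ} (hu : ∀ t, HasDerivAt u (u' t) t)
    (h : ∀ t, |u' t| ≤ M) (a b : ℝ) : |u b - u a| ≤ M * |b - a| := by
  have := Convex.norm_image_sub_le_of_norm_hasDerivWithin_le (f := u) (f' := u') (C := M)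
    (s := univ) (x := a) (y := b) (fun t _ => (hu t).hasDerivWithinAt) (fun t _ => h t)
    convex_univ (mem_univ _) (mem_univ _)
  simpa [Real.norm_eq_abs] using this

/-- positive derivative: larger values just to the right -/
theorem aux_right {u : ℝ → ℝ} {d t η : ℝ} (hu : HasDerivAt u d t) (hd : 0 < d) (hη : 0 < η) :
    ∃ v, t < v ∧ v < t + η ∧ u t < u v := by
  have h1 := (hasDerivAt_iff_tendsto_slope.1 hu).mono_left
    (nhdsWithin_mono t (fun x (hx : x ∈ Ioi t) => ne_of_gt hx))
  have h2 := h1.eventually (lt_mem_nhds hd)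
  have h3 : ∀ᶠ v in 𝓝[>] t, v ∈ Ioo t (t + η) := Ioo_mem_nhdsGT (by linarith)
  obtain ⟨v, hv, hv2⟩ := (h2.and h3).exists
  refine ⟨v, hv2.1, hv2.2, ?_⟩
  rw [slope_def_field] at hv
  have h4 : 0 < v - t := by linarith [hv2.1]
  have := mul_pos hv h4
  rw [div_mul_cancel₀ _ h4.ne'] at this
  linarith

theorem aux_left {u : ℝ → ℝ} {d t a : ℝ} (hu : HasDerivAt u d t) (hat : a < t)
    (h : ∀ v, a < v → v < t → u v ≤ u t) : 0 ≤ d := by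
  by_contra hd
  push Not at hd
  have hu' : HasDerivAt (fun v => u (-v)) (-d) (-t) := by
    have h0 : HasDerivAt u d (- -t) := by simpa using hu
    have := h0.comp (-t) (hasDerivAt_neg (-t))
    simpa [Function.comp_def] using this
  obtain ⟨v, h1, h2, h3⟩ := aux_right hu' (by linarith : 0 < -d) (by linarith : 0 < t - a)
  have := h (-v) (by linarith) (by linarith)
  simp at h3
  linarith

theorem aux_negbound {u : ℝ → ℝ} (hu : Continuous u) (a b : ℝ)
    (h : ∀ t ∈ Icc a b, u t < 0) : ∃ c > 0, ∀ t ∈ Icc a b, u t ≤ -c := by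
  rcases (Icc a b).eq_empty_or_nonempty with he | hne
  · exact ⟨1, one_pos, by simp [he]⟩
  · obtain ⟨m, hm, hmax⟩ := isCompact_Icc.exists_isMaxOn hne hu.continuousOn
    exact ⟨-u m, by linarith [h m hm], fun t ht => by simpa using hmax ht⟩

/-- `z` is nonpositive up to its first return to zero, and `x ≥ 0` there. -/
theorem aux_first_s12 {x z : ℝ → ℝ} {ε τ th : ℝ} (hε : 0 < ε)
    (hZ : ∀ t, HasDerivAt z ((x t + |z t|) / ε) t)
    (hz : z τ = 0) (hx : x τ < 0)
    (hth : IsLeast {t | τ < t ∧ z t = 0} th) :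
    (∀ t ∈ Icc τ th, z t ≤ 0) ∧ 0 ≤ x th := by
  obtain ⟨⟨h1, h2⟩, h3⟩ := hth
  have hzc : Continuous z := continuous_iff_continuousAt.2 fun t => (hZ t).continuousAt
  have hneg : ∀ t ∈ Ioo τ th, z t < 0 := by
    intro t ht
    by_contra hcon
    push Not at hcon
    have hd : 0 < -((x τ + |z τ|) / ε) := by
      rw [hz, abs_zero, add_zero, ← neg_div]
      exact div_pos (by linarith) hε
    obtain ⟨v, hv1, hv2, hv3⟩ := aux_right (hZ τ).neg hd (by linarith [ht.1] : 0 < t - τ)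
    simp [hz] at hv3
    obtain ⟨w, hw, hw0⟩ := intermediate_value_Icc (by linarith : v ≤ t) hzc.continuousOn
      (⟨hv3.le, hcon⟩ : (0:ℝ) ∈ Icc (z v) (z t))
    have := h3 (⟨by linarith [hw.1], hw0⟩ : τ < w ∧ z w = 0)
    linarith [hw.2, ht.2]
  constructor
  · intro t ht
    rcases ht.1.eq_or_lt with rfl | ha
    · exact hz.le
    rcases ht.2.eq_or_lt with rfl | hb
    · exact h2.le
    exact (hneg t ⟨ha, hb⟩).le
  · have := aux_left (hZ th) h1 (fun v hv hv' => by rw [h2]; exact (hneg v ⟨hv, hv'⟩).le)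
    rw [h2, abs_zero, add_zero] at this
    have h4 := mul_nonneg this hε.le
    rwa [div_mul_cancel₀ _ hε.ne'] at h4

/-- fast variable estimates -/
theorem aux_fast {x z F : ℝ → ℝ} {ε τ th M : ℝ} (hε : 0 < ε) (hM : 0 < M)
    (hX : ∀ t, HasDerivAt x (F t) t) (hF : ∀ t, |F t| ≤ M)
    (hZ : ∀ t, HasDerivAt z ((x t + |z t|) / ε) t)
    (hz : z τ = 0) (hx : x τ < 0)
    (hneg : ∀ t ∈ Icc τ th, z t ≤ 0) (t : ℝ) (ht : t ∈ Icc τ th) :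
    x t - z t ≤ M * ε ∧ |x t - z t| ≤ -x τ * Real.exp (-(t - τ) / ε) + M * ε := by
  have hE : ∀ v, HasDerivAt (fun v => Real.exp ((v - τ) / ε)) (Real.exp ((v - τ) / ε) * (1 / ε)) v :=
    fun v => (((hasDerivAt_id v).sub_const τ).div_const ε).exp
  have hup : x t - z t ≤ M * ε := by
    have hd : ∀ v, HasDerivAt (fun v => (M * ε - (x v - z v)) * Real.exp ((v - τ) / ε))
        ((-(F v - (x v + |z v|) / ε)) * Real.exp ((v - τ) / ε) +
          (M * ε - (x v - z v)) * (Real.exp ((v - τ) / ε) * (1 / ε))) v :=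
      fun v => (((hX v).sub (hZ v)).const_sub (M * ε)).mul (hE v)
    have := aux_mono ht.1 hd (by
      intro v hv
      rw [abs_of_nonpos (hneg v ⟨hv.1.le, hv.2.le.trans ht.2⟩)]
      have : -(F v - (x v + -z v) / ε) * Real.exp ((v - τ) / ε) +
          (M * ε - (x v - z v)) * (Real.exp ((v - τ) / ε) * (1 / ε)) =
          (M - F v) * Real.exp ((v - τ) / ε) := by field_simp; ring
      rw [this]
      exact mul_nonneg (by linarith [(abs_le.1 (hF v)).2]) (Real.exp_pos _).le)
    simp only [hz, sub_self, zero_div, Real.exp_zero, mul_one, sub_zero] at this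
    have h0 : 0 < M * ε := mul_pos hM hε
    have h5 : 0 ≤ (M * ε - (x t - z t)) := nonneg_of_mul_nonneg_left
      (by linarith : 0 ≤ (M * ε - (x t - z t)) * Real.exp ((t - τ) / ε)) (Real.exp_pos _)
    linarith
  refine ⟨hup, ?_⟩
  have hlow : x τ * Real.exp (-(t - τ) / ε) ≤ x t - z t + M * ε := by
    have hd : ∀ v, HasDerivAt (fun v => ((x v - z v) + M * ε) * Real.exp ((v - τ) / ε))
        (((F v - (x v + |z v|) / ε)) * Real.exp ((v - τ) / ε) +
          ((x v - z v) + M * ε) * (Real.exp ((v - τ) / ε) * (1 / ε))) v :=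
      fun v => (((hX v).sub (hZ v)).add_const (M * ε)).mul (hE v)
    have := aux_mono ht.1 hd (by
      intro v hv
      rw [abs_of_nonpos (hneg v ⟨hv.1.le, hv.2.le.trans ht.2⟩)]
      have : (F v - (x v + -z v) / ε) * Real.exp ((v - τ) / ε) +
          ((x v - z v) + M * ε) * (Real.exp ((v - τ) / ε) * (1 / ε)) =
          (M + F v) * Real.exp ((v - τ) / ε) := by field_simp; ring
      rw [this]
      exact mul_nonneg (by linarith [(abs_le.1 (hF v)).1]) (Real.exp_pos _).le)
    simp only [hz, sub_self, zero_div, Real.exp_zero, mul_one, sub_zero] at this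
    have h0 : 0 < M * ε := mul_pos hM hε
    have h6 : x τ ≤ (x t - z t + M * ε) * Real.exp ((t - τ) / ε) := by linarith
    have h7 := mul_le_mul_of_nonneg_right h6 (Real.exp_pos (-(t - τ) / ε)).le
    rw [mul_assoc, ← Real.exp_add] at h7
    have : (t - τ) / ε + -(t - τ) / ε = 0 := by ring
    rwa [this, Real.exp_zero, mul_one] at h7
  have h0 : 0 ≤ -x τ * Real.exp (-(t - τ) / ε) := mul_nonneg (by linarith) (Real.exp_pos _).le
  rw [abs_le]
  constructor <;> linarith

theorem aux_track {f g : ℝ → ℝ → ℝ → ℝ} {M lam τ Tr x₀ y₀ : ℝ} (hM : 0 < M) (hlam : 0 ≤ lam)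
    (hbound : ∀ x y z : ℝ, |f x y z| < M ∧ |g x y z| < M)
    (hLipf : ∀ x₁ y₁ z₁ x₂ y₂ z₂ : ℝ,
      |f x₁ y₁ z₁ - f x₂ y₂ z₂| ≤ lam * (|x₁ - x₂| + |y₁ - y₂| + |z₁ - z₂|))
    (hLipg : ∀ x₁ y₁ z₁ x₂ y₂ z₂ : ℝ,
      |g x₁ y₁ z₁ - g x₂ y₂ z₂| ≤ lam * (|x₁ - x₂| + |y₁ - y₂| + |z₁ - z₂|))
    (hτ : τ < Tr) (hx₀ : x₀ < 0)
    {xa ya : ℝ → ℝ}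
    (hxa : ∀ t : ℝ, HasDerivAt xa (f (xa t) (ya t) (xa t)) t)
    (hya : ∀ t : ℝ, HasDerivAt ya (g (xa t) (ya t) (xa t)) t)
    (hxaτ : xa τ = x₀) (hyaτ : ya τ = y₀) :
    ∃ C > 0, ∀ (ε : ℝ) (x y z : ℝ → ℝ) (th : ℝ), 0 < ε →
      (∀ t, HasDerivAt x (f (x t) (y t) (z t)) t) →
      (∀ t, HasDerivAt y (g (x t) (y t) (z t)) t) →
      (∀ t, HasDerivAt z ((x t + |z t|) / ε) t) →
      x τ = x₀ → y τ = y₀ → z τ = 0 → th ≤ Tr →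
      (∀ t ∈ Icc τ th, z t ≤ 0) →
      ∀ t ∈ Icc τ th, x t - z t ≤ M * ε ∧ |x t - xa t| ≤ C * ε ∧ |y t - ya t| ≤ C * ε := by
  set K : ℝ := 3 * lam + 1 with hK
  have hK0 : 0 < K := by positivity
  have hT : 0 < Tr - τ := by linarith
  have hx0' : 0 < -x₀ := by linarith
  refine ⟨Real.exp (K * (Tr - τ)) * (lam * -x₀ + M * lam * (Tr - τ) + 1), by positivity, ?_⟩
  intro ε x y z th hε hX hY hZ hxτ hyτ hzτ hth hneg
  have hfast := fun t ht => aux_fast hε hM hX (fun t => (hbound (x t) (y t) (z t)).1.le) hZ hzτ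
    (by rw [hxτ]; exact hx₀) hneg t ht
  let Q : ℝ → ℝ := fun t => ε * (lam * -x₀ * (1 - Real.exp (-(t - τ) / ε)) + M * lam * (t - τ) + 1)
  let B : ℝ → ℝ := fun t => Real.exp (K * (t - τ)) * Q t
  have hQ' : ∀ t, HasDerivAt Q (lam * -x₀ * Real.exp (-(t - τ) / ε) + ε * (M * lam)) t := by
    intro t
    have h1 : HasDerivAt (fun t => Real.exp (-(t - τ) / ε)) (Real.exp (-(t - τ) / ε) * (-1 / ε)) t :=
      ((((hasDerivAt_id t).sub_const τ).neg).div_const ε).exp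
    have h2 := (((((h1.const_sub 1).const_mul (lam * -x₀)).add
      (((hasDerivAt_id t).sub_const τ).const_mul (M * lam))).add_const 1).const_mul ε)
    refine h2.congr_deriv ?_
    field_simp
  have hB' : ∀ t, HasDerivAt B (Real.exp (K * (t - τ)) * (K * 1) * Q t + Real.exp (K * (t - τ)) *
      (lam * -x₀ * Real.exp (-(t - τ) / ε) + ε * (M * lam))) t := by
    intro t
    exact ((((hasDerivAt_id t).sub_const τ).const_mul K).exp).mul (hQ' t)
  have hQpos : ∀ t, τ ≤ t → 0 < Q t := by
    intro t ht
    have h1 : Real.exp (-(t - τ) / ε) ≤ 1 := by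
      rw [Real.exp_le_one_iff]
      exact div_nonpos_of_nonpos_of_nonneg (by linarith) hε.le
    have h2 : 0 ≤ lam * -x₀ * (1 - Real.exp (-(t - τ) / ε)) :=
      mul_nonneg (by positivity) (by linarith)
    have h3 : 0 ≤ M * lam * (t - τ) := mul_nonneg (by positivity) (by linarith)
    exact mul_pos hε (by linarith)
  let D : ℝ → ℝ × ℝ := fun t => (x t - xa t, y t - ya t)
  have hD : ∀ t, HasDerivAt D (f (x t) (y t) (z t) - f (xa t) (ya t) (xa t),
      g (x t) (y t) (z t) - g (xa t) (ya t) (xa t)) t :=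
    fun t => ((hX t).sub (hxa t)).prodMk ((hY t).sub (hya t))
  have key := image_norm_le_of_norm_deriv_right_lt_deriv_boundary' (f := D) (a := τ) (b := th)
    (B := B)
    (fun t _ => (hD t).continuousAt.continuousWithinAt) (fun t _ => (hD t).hasDerivWithinAt)
    (by
      have : D τ = 0 := by simp [D, hxτ, hyτ, hxaτ, hyaτ]
      rw [this, norm_zero]
      exact (mul_pos (Real.exp_pos _) (hQpos τ le_rfl)).le)
    (fun t _ => (hB' t).continuousAt.continuousWithinAt) (fun t _ => (hB' t).hasDerivWithinAt)
    (by
      intro t ht hEq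
      have ht' : t ∈ Icc τ th := ⟨ht.1, ht.2.le⟩
      have hBpos : 0 < B t := mul_pos (Real.exp_pos _) (hQpos t ht.1)
      have h1 : |x t - xa t| ≤ B t := by rw [← hEq]; exact norm_fst_le (D t)
      have h2 : |y t - ya t| ≤ B t := by rw [← hEq]; exact norm_snd_le (D t)
      have h3 := (hfast t ht').2
      rw [hxτ] at h3
      have h4 : |z t - xa t| ≤ |x t - z t| + |x t - xa t| := by
        have := abs_sub_abs_le_abs_sub (z t - xa t) (x t - xa t)
        have h5 : (z t - xa t) - (x t - xa t) = -(x t - z t) := by ring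
        rw [h5, abs_neg] at this
        linarith
      set U := -x₀ * Real.exp (-(t - τ) / ε) + M * ε with hU
      have hU0 : 0 ≤ U := by positivity
      have h6 : lam * (|x t - xa t| + |y t - ya t| + |z t - xa t|) ≤ lam * (3 * B t + U) :=
        mul_le_mul_of_nonneg_left (by linarith) hlam
      have h7 : lam * (3 * B t + U) < Real.exp (K * (t - τ)) * (K * 1) * Q t +
          Real.exp (K * (t - τ)) * (lam * -x₀ * Real.exp (-(t - τ) / ε) + ε * (M * lam)) := by
        have e1 : Real.exp (K * (t - τ)) * (K * 1) * Q t = K * B t := by simp only [B]; ring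
        have e2 : lam * -x₀ * Real.exp (-(t - τ) / ε) + ε * (M * lam) = lam * U := by
          rw [hU]; ring
        rw [e1, e2]
        have e3 : 1 ≤ Real.exp (K * (t - τ)) :=
          Real.one_le_exp (mul_nonneg hK0.le (by linarith [ht.1]))
        have e4 : 1 * (lam * U) ≤ Real.exp (K * (t - τ)) * (lam * U) :=
          mul_le_mul_of_nonneg_right e3 (by positivity)
        rw [hK]
        nlinarith
      refine lt_of_le_of_lt ?_ h7
      refine max_le ?_ ?_
      · exact (hLipf _ _ _ _ _ _).trans h6
      · exact (hLipg _ _ _ _ _ _).trans h6)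
  intro t ht
  have hBt : B t ≤ Real.exp (K * (Tr - τ)) * (lam * -x₀ + M * lam * (Tr - τ) + 1) * ε := by
    have e1 : Real.exp (K * (t - τ)) ≤ Real.exp (K * (Tr - τ)) :=
      Real.exp_le_exp.2 (mul_le_mul_of_nonneg_left (by linarith [ht.2]) hK0.le)
    have e2 : Q t ≤ ε * (lam * -x₀ + M * lam * (Tr - τ) + 1) := by
      refine mul_le_mul_of_nonneg_left ?_ hε.le
      have a1 : lam * -x₀ * (1 - Real.exp (-(t - τ) / ε)) ≤ lam * -x₀ * 1 :=
        mul_le_mul_of_nonneg_left (by linarith [Real.exp_pos (-(t - τ) / ε)]) (by positivity)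
      have a2 : M * lam * (t - τ) ≤ M * lam * (Tr - τ) :=
        mul_le_mul_of_nonneg_left (by linarith [ht.2]) (by positivity)
      linarith
    calc B t ≤ Real.exp (K * (Tr - τ)) * (ε * (lam * -x₀ + M * lam * (Tr - τ) + 1)) :=
          mul_le_mul e1 e2 (hQpos t ht.1).le (Real.exp_pos _).le
      _ = _ := by ring
  have hk := (key ht).trans hBt
  exact ⟨(hfast t ht).1, (norm_fst_le (D t)).trans hk, (norm_snd_le (D t)).trans hk⟩

/-- Behaviour of the attractive reduced flow after hitting `y = 0` in `x ≤ 0`. -/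
theorem aux_after {f g : ℝ → ℝ → ℝ → ℝ} {M lam δ ρ ttil : ℝ} (hM : 0 < M) (hlam : 0 ≤ lam)
    (hbound : ∀ x y z : ℝ, |f x y z| < M ∧ |g x y z| < M)
    (hLipf : ∀ x₁ y₁ z₁ x₂ y₂ z₂ : ℝ,
      |f x₁ y₁ z₁ - f x₂ y₂ z₂| ≤ lam * (|x₁ - x₂| + |y₁ - y₂| + |z₁ - z₂|))
    (hf000 : f 0 0 0 = 0)
    (hyf : ∀ y : ℝ, y ≠ 0 → y * f 0 y 0 < 0)
    (hgpos : ∀ x y z : ℝ, |x| ≤ δ → |y| ≤ δ → |z| ≤ δ → 0 < g x y z)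
    (hρδ : ρ < δ / (2 * M))
    {xa ya : ℝ → ℝ}
    (hxa : ∀ t : ℝ, HasDerivAt xa (f (xa t) (ya t) (xa t)) t)
    (hya : ∀ t : ℝ, HasDerivAt ya (g (xa t) (ya t) (xa t)) t)
    (hx : xa ttil ≤ 0) (hy : ya ttil = 0) :
    ∀ t, ttil < t → t ≤ ttil + ρ → xa t < 0 := by
  have hMρ : M * ρ < δ / 2 := by
    rw [lt_div_iff₀ (by positivity)] at hρδ
    linarith
  have lx : ∀ t, ttil ≤ t → t ≤ ttil + ρ → |xa t - xa ttil| < δ / 2 := by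
    intro t h1 h2
    have := aux_lip hxa (fun t => (hbound _ _ _).1.le) ttil t
    rw [abs_of_nonneg (by linarith : 0 ≤ t - ttil)] at this
    have h3 : M * (t - ttil) ≤ M * ρ := mul_le_mul_of_nonneg_left (by linarith) hM.le
    linarith
  have ly : ∀ t, ttil ≤ t → t ≤ ttil + ρ → |ya t| < δ / 2 := by
    intro t h1 h2
    have := aux_lip hya (fun t => (hbound _ _ _).2.le) ttil t
    rw [abs_of_nonneg (by linarith : 0 ≤ t - ttil), hy, sub_zero] at this
    have h3 : M * (t - ttil) ≤ M * ρ := mul_le_mul_of_nonneg_left (by linarith) hM.le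
    linarith
  intro t ht1 ht2
  have hδ : 0 < δ := by
    have := ly t ht1.le ht2
    linarith [abs_nonneg (ya t)]
  by_cases hfar : xa ttil < -(δ / 2)
  · have := (abs_lt.1 (lx t ht1.le ht2)).2
    linarith
  push Not at hfar
  have hypos : ∀ v, ttil < v → v ≤ ttil + ρ → 0 < ya v := by
    intro v hv1 hv2
    have := aux_strictmono hv1 hya (by
      intro w hw
      have h1 := abs_lt.1 (lx w hw.1.le (by linarith [hw.2]))
      have h2 : |xa w| ≤ δ := by rw [abs_le]; constructor <;> linarith
      exact hgpos _ _ _ h2 (by linarith [ly w hw.1.le (by linarith [hw.2])]) h2)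
    linarith
  have hle : ∀ v, ttil ≤ v → v ≤ ttil + ρ → xa v ≤ 0 := by
    intro v hv1 hv2
    by_contra hcon
    push Not at hcon
    set L := 2 * lam + 1 with hL
    have hL0 : 0 < L := by positivity
    let B : ℝ → ℝ → ℝ := fun κ w => κ * Real.exp (L * (w - ttil))
    have hB' : ∀ κ w, HasDerivAt (B κ) (κ * (Real.exp (L * (w - ttil)) * (L * 1))) w :=
      fun κ w => ((((hasDerivAt_id w).sub_const ttil).const_mul L).exp).const_mul κ
    have key : ∀ κ > 0, xa v ≤ B κ v := by
      intro κ hκ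
      have := image_le_of_deriv_right_lt_deriv_boundary' (f := xa) (a := ttil) (b := v) (B := B κ)
        (fun t _ => (hxa t).continuousAt.continuousWithinAt)
        (fun t _ => (hxa t).hasDerivWithinAt)
        (by simp [B]; linarith)
        (fun t _ => (hB' κ t).continuousAt.continuousWithinAt)
        (fun t _ => (hB' κ t).hasDerivWithinAt)
        (by
          intro w hw he
          have hpos : 0 < xa w := by rw [he]; exact mul_pos hκ (Real.exp_pos _)
          have h1 := (abs_le.1 (hLipf (xa w) (ya w) (xa w) 0 (ya w) 0)).2
          simp only [sub_zero, sub_self, abs_zero, abs_of_pos hpos] at h1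
          have h2 : f 0 (ya w) 0 ≤ 0 := by
            rcases hw.1.eq_or_lt with rfl | hlt
            · rw [hy, hf000]
            · have hp := hypos w hlt (by linarith [hw.2])
              have := hyf (ya w) hp.ne'
              exact (neg_of_mul_neg_right this hp.le).le
          have h3 : κ * (Real.exp (L * (w - ttil)) * (L * 1)) = L * xa w := by
            rw [he]; simp only [B]; ring
          rw [h3, hL]
          nlinarith)
      exact this ⟨hv1, le_rfl⟩
    have h1 := key (xa v / (2 * Real.exp (L * (v - ttil)))) (by positivity)
    have h2 : B (xa v / (2 * Real.exp (L * (v - ttil)))) v = xa v / 2 := by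
      simp only [B]; field_simp
    linarith
  by_contra hcon
  have h0 : xa t = 0 := le_antisymm (hle t ht1.le ht2) (not_lt.1 hcon)
  have h1 := aux_left (hxa t) ht1 (fun v hv hv' => by
    rw [h0]; exact hle v hv.le (by linarith))
  rw [h0] at h1
  have hp := hypos t ht1 ht2
  have := hyf (ya t) hp.ne'
  nlinarith

/-- Escape: crossing with `f > 0` leads to `z` staying positive forever. -/
theorem aux_escape {f g : ℝ → ℝ → ℝ → ℝ} {M lam ε p r κ ys th : ℝ} (hM : 0 < M) (hlam : 0 ≤ lam)
    (hbound : ∀ x y z : ℝ, |f x y z| < M ∧ |g x y z| < M)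
    (hLipf : ∀ x₁ y₁ z₁ x₂ y₂ z₂ : ℝ,
      |f x₁ y₁ z₁ - f x₂ y₂ z₂| ≤ lam * (|x₁ - x₂| + |y₁ - y₂| + |z₁ - z₂|))
    {x y z : ℝ → ℝ} (hε : 0 < ε)
    (hX : ∀ t, HasDerivAt x (f (x t) (y t) (z t)) t)
    (hY : ∀ t, HasDerivAt y (g (x t) (y t) (z t)) t)
    (hZ : ∀ t, HasDerivAt z ((x t + |z t|) / ε) t)
    (hp : 0 < p) (hpf : p = f 0 ys 0) (hr : 0 < r) (hrp : lam * (3 * r) ≤ p / 2)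
    (hκ : 0 < κ) (hMκ : M * κ ≤ r / 2)
    (hz : z th = 0) (hx0 : 0 ≤ x th) (hxr : x th ≤ r / 2) (hyr : |y th - ys| ≤ r / 2)
    (hεr : M * ε < r) (hεκ : 4 * ε * r < p * κ ^ 2) :
    ∀ t, th + κ ≤ t → 0 < z t := by
  have hzc : Continuous z := continuous_iff_continuousAt.2 fun t => (hZ t).continuousAt
  -- claim inside the box
  have claim : ∀ b, th ≤ b → b ≤ th + κ → (∀ t ∈ Ico th b, |z t| ≤ r) →
      0 ≤ x b ∧ p * (b - th) ^ 2 / (4 * ε) ≤ z b := by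
    intro b hb1 hb2 hzr
    have hxx : ∀ t ∈ Icc th b, p / 2 * (t - th) ≤ x t := by
      intro t ht
      have hd : ∀ v, HasDerivAt (fun v => x v - p / 2 * (v - th))
          (f (x v) (y v) (z v) - p / 2 * 1) v :=
        fun v => (hX v).sub (((hasDerivAt_id v).sub_const th).const_mul (p / 2))
      have := aux_mono ht.1 hd (by
        intro v hv
        have hvb : v - th ≤ κ := by linarith [hv.2, ht.2]
        have hMv : M * (v - th) ≤ M * κ := mul_le_mul_of_nonneg_left hvb hM.le
        have l1 := aux_lip hX (fun t => (hbound _ _ _).1.le) th v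
        have l2 := aux_lip hY (fun t => (hbound _ _ _).2.le) th v
        rw [abs_of_nonneg (by linarith [hv.1] : 0 ≤ v - th)] at l1 l2
        have b1 : |x v - 0| ≤ r := by
          rw [sub_zero, abs_le]; rw [abs_le] at l1; constructor <;> linarith
        have b2 : |y v - ys| ≤ r := by
          have := abs_sub_le (y v) (y th) ys
          linarith
        have b3 : |z v - 0| ≤ r := by
          rw [sub_zero]; exact hzr v ⟨hv.1.le, by linarith [hv.2, ht.2]⟩
        have h1 := (abs_le.1 (hLipf (x v) (y v) (z v) 0 ys 0)).1
        have h2 : lam * (|x v - 0| + |y v - ys| + |z v - 0|) ≤ lam * (3 * r) :=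
          mul_le_mul_of_nonneg_left (by linarith) hlam
        linarith)
      simp only [sub_self, mul_zero, sub_zero] at this
      linarith
    constructor
    · exact le_trans (mul_nonneg (by linarith) (by linarith)) (hxx b ⟨hb1, le_rfl⟩)
    · have hd : ∀ v, HasDerivAt (fun v => z v - p / (4 * ε) * (v - th) ^ 2)
          ((x v + |z v|) / ε - p / (4 * ε) * (((2 : ℕ) : ℝ) * (v - th) ^ (2 - 1) * 1)) v :=
        fun v => (hZ v).sub ((((hasDerivAt_id v).sub_const th).pow 2).const_mul (p / (4 * ε)))
      have := aux_mono hb1 hd (by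
        intro v hv
        have h1 := hxx v ⟨hv.1.le, hv.2.le⟩
        have h2 : (x v + |z v|) / ε - p / (4 * ε) * (((2 : ℕ) : ℝ) * (v - th) ^ (2 - 1) * 1)
            = (x v - p / 2 * (v - th) + |z v|) / ε := by
          push_cast; field_simp; norm_num; ring
        rw [h2]
        exact div_nonneg (by linarith [abs_nonneg (z v)]) hε.le)
      simp only [hz, sub_self] at this
      have e : p * (b - th) ^ 2 / (4 * ε) = p / (4 * ε) * (b - th) ^ 2 := by ring
      rw [e]
      norm_num at this
      linarith
  have hbig : r < p * κ ^ 2 / (4 * ε) := by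
    rw [lt_div_iff₀ (by positivity)]; linarith
  have hSne : (Icc th (th + κ) ∩ {t | r ≤ |z t|}).Nonempty := by
    by_contra hcon
    rw [not_nonempty_iff_eq_empty] at hcon
    have hall : ∀ t ∈ Icc th (th + κ), |z t| < r := by
      intro t ht
      by_contra h
      have : t ∈ Icc th (th + κ) ∩ {t | r ≤ |z t|} := ⟨ht, not_lt.1 h⟩
      rw [hcon] at this
      exact this
    have h1 := (claim (th + κ) (by linarith) le_rfl
      (fun t ht => (hall t ⟨ht.1, ht.2.le⟩).le)).2
    have h2 := (abs_lt.1 (hall (th + κ) ⟨by linarith, le_rfl⟩)).2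
    rw [add_sub_cancel_left] at h1
    linarith
  obtain ⟨t1, ⟨ht1, hzt1⟩, hleast⟩ := (isCompact_Icc.inter_right
    (isClosed_le continuous_const hzc.abs)).exists_isLeast hSne
  have hcl := claim t1 ht1.1 ht1.2 (by
    intro t ht
    by_contra h
    have := hleast (⟨⟨ht.1, by linarith [ht.2, ht1.2]⟩, (not_le.1 h).le⟩ :
      t ∈ Icc th (th + κ) ∩ {t | r ≤ |z t|})
    linarith [ht.2])
  have hz0 : 0 ≤ z t1 := le_trans (by positivity) hcl.2
  have hzr : r ≤ z t1 := by
    have h : r ≤ |z t1| := hzt1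
    rwa [abs_of_nonneg hz0] at h
  intro t ht
  have hd : ∀ v, HasDerivAt (fun v => r + M * (v - t1)) (M * 1) v :=
    fun v => (((hasDerivAt_id v).sub_const t1).const_mul M).const_add r
  have hfin := image_le_of_deriv_right_lt_deriv_boundary' (a := t1) (b := t)
    (f := fun v => r + M * (v - t1)) (B := z)
    (fun t _ => (hd t).continuousAt.continuousWithinAt)
    (fun t _ => (hd t).hasDerivWithinAt)
    (by simpa using hzr)
    (fun t _ => (hZ t).continuousAt.continuousWithinAt)
    (fun t _ => (hZ t).hasDerivWithinAt)
    (by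
      intro v hv he
      have he' : r + M * (v - t1) = z v := he
      have l1 := aux_lip hX (fun t => (hbound _ _ _).1.le) t1 v
      rw [abs_of_nonneg (by linarith [hv.1] : 0 ≤ v - t1)] at l1
      have l2 := (abs_le.1 l1).1
      rw [lt_div_iff₀ hε]
      linarith [le_abs_self (z v), hcl.1])
    (⟨by linarith [ht1.2], le_rfl⟩ : t ∈ Icc t1 t)
  have : 0 ≤ M * (t - t1) := mul_nonneg hM.le (by linarith [ht1.2])
  linarith

/-- In the canard setting, for every sufficiently small `ε > 0`
(among those `ε` for which the stated hypotheses hold) one has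
`|t̂_ε - t̃| ≤ ρ/4` and `0 ≤ x_ε(t̂_ε) ≤ Mε`; moreover `y_ε(t̂_ε) → 0` as
`ε → 0` along such `ε`. -/
theorem first_zero_near_ttilde
    (M lam δ ρ τ ttil Tr x₀ y₀ : ℝ) (hM : 0 < M) (hlam : 0 ≤ lam)
    (f g : ℝ → ℝ → ℝ → ℝ)
    -- Assumption 1: global boundedness and global Lipschitz continuity
    (hbound : ∀ x y z : ℝ, |f x y z| < M ∧ |g x y z| < M)
    (hLipf : ∀ x₁ y₁ z₁ x₂ y₂ z₂ : ℝ,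
      |f x₁ y₁ z₁ - f x₂ y₂ z₂| ≤ lam * (|x₁ - x₂| + |y₁ - y₂| + |z₁ - z₂|))
    (hLipg : ∀ x₁ y₁ z₁ x₂ y₂ z₂ : ℝ,
      |g x₁ y₁ z₁ - g x₂ y₂ z₂| ≤ lam * (|x₁ - x₂| + |y₁ - y₂| + |z₁ - z₂|))
    -- Assumption 2
    (hf000 : f 0 0 0 = 0) (hg000 : 0 < g 0 0 0)
    (hyf : ∀ y : ℝ, y ≠ 0 → y * f 0 y 0 < 0)
    -- choice of δ and ρ
    (hδ : 0 < δ)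
    (hgpos : ∀ x y z : ℝ, |x| ≤ δ → |y| ≤ δ → |z| ≤ δ → 0 < g x y z)
    (hρ : 0 < ρ) (hρδ : ρ < δ / (2 * M))
    -- the time moments
    (hτttil : τ < ttil) (httilTr : ttil < Tr) (httilρ : ttil + ρ < Tr)
    (hx₀ : x₀ < 0)
    -- (x_a, y_a) is the solution of the attractive reduced system
    (xa ya : ℝ → ℝ)
    (hxa : ∀ t : ℝ, HasDerivAt xa (f (xa t) (ya t) (xa t)) t)
    (hya : ∀ t : ℝ, HasDerivAt ya (g (xa t) (ya t) (xa t)) t)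
    (hxaτ : xa τ = x₀) (hyaτ : ya τ = y₀)
    (hxaneg : ∀ t : ℝ, τ ≤ t → t < ttil → xa t < 0)
    -- (x_a(t̃), y_a(t̃)) ∈ R
    (hR : (xa ttil = 0 ∧ ya ttil ≤ 0) ∨ (xa ttil ≤ 0 ∧ ya ttil = 0))
    -- for each ε > 0, (X ε, Y ε, Z ε) is the solution of the slow–fast system
    (X Y Z : ℝ → ℝ → ℝ)
    (hX : ∀ ε : ℝ, 0 < ε → ∀ t : ℝ,
      HasDerivAt (X ε) (f (X ε t) (Y ε t) (Z ε t)) t)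
    (hY : ∀ ε : ℝ, 0 < ε → ∀ t : ℝ,
      HasDerivAt (Y ε) (g (X ε t) (Y ε t) (Z ε t)) t)
    (hZ : ∀ ε : ℝ, 0 < ε → ∀ t : ℝ,
      HasDerivAt (Z ε) ((X ε t + |Z ε t|) / ε) t)
    (hIC : ∀ ε : ℝ, 0 < ε → X ε τ = x₀ ∧ Y ε τ = y₀ ∧ Z ε τ = 0)
    -- t̂_ε and s_ε
    (th s : ℝ → ℝ) :
    (∃ ε₀ > (0 : ℝ), ∀ ε : ℝ, 0 < ε → ε < ε₀ →
      IsLeast {t | τ < t ∧ Z ε t = 0} (th ε) →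
      IsLeast (insert Tr {t | (ttil + ρ ≤ t ∧ t ≤ Tr) ∧ Z ε t ≤ 0}) (s ε) →
      s ε < Tr → Z ε (s ε) = 0 →
      |th ε - ttil| ≤ ρ / 4 ∧ 0 ≤ X ε (th ε) ∧ X ε (th ε) ≤ M * ε) ∧
    (∀ η > (0 : ℝ), ∃ ε₁ > (0 : ℝ), ∀ ε : ℝ, 0 < ε → ε < ε₁ →
      IsLeast {t | τ < t ∧ Z ε t = 0} (th ε) →
      IsLeast (insert Tr {t | (ttil + ρ ≤ t ∧ t ≤ Tr) ∧ Z ε t ≤ 0}) (s ε) →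
      s ε < Tr → Z ε (s ε) = 0 →
      |Y ε (th ε)| ≤ η) := by
  have hτTr : τ < Tr := by linarith
  obtain ⟨C, hC, htrack⟩ := aux_track hM hlam hbound hLipf hLipg hτTr hx₀ hxa hya hxaτ hyaτ
  have hxac : Continuous xa := continuous_iff_continuousAt.2 fun t => (hxa t).continuousAt
  -- facts valid for every admissible ε
  have base : ∀ ε : ℝ, 0 < ε → IsLeast {t | τ < t ∧ Z ε t = 0} (th ε) →
      IsLeast (insert Tr {t | (ttil + ρ ≤ t ∧ t ≤ Tr) ∧ Z ε t ≤ 0}) (s ε) →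
      s ε < Tr → Z ε (s ε) = 0 →
      τ < th ε ∧ Z ε (th ε) = 0 ∧ th ε ≤ ttil + ρ ∧ ttil + ρ ≤ s ε ∧ 0 ≤ X ε (th ε) ∧
      (∀ t ∈ Icc τ (th ε), Z ε t ≤ 0) ∧
      (∀ t ∈ Icc τ (th ε), X ε t - Z ε t ≤ M * ε ∧ |X ε t - xa t| ≤ C * ε ∧
        |Y ε t - ya t| ≤ C * ε) := by
    intro ε hε hth hs hsT hZs
    obtain ⟨i1, i2, i3⟩ := hIC ε hε
    obtain ⟨a1, a2⟩ := aux_first_s12 hε (hZ ε hε) i3 (by rw [i1]; exact hx₀) hth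
    have hsge : ttil + ρ ≤ s ε := by
      rcases hs.1 with h | h
      · exact absurd h hsT.ne
      · exact h.1.1
    have hz1 : 0 ≤ Z ε (ttil + ρ) := by
      by_contra hcon
      have h1 := hs.2 (Or.inr ⟨⟨le_rfl, httilρ.le⟩, (not_le.1 hcon).le⟩ :
        ttil + ρ ∈ insert Tr {t | (ttil + ρ ≤ t ∧ t ≤ Tr) ∧ Z ε t ≤ 0})
      have h2 : s ε = ttil + ρ := le_antisymm h1 hsge
      rw [h2] at hZs
      exact hcon hZs.ge
    have hthle : th ε ≤ ttil + ρ := by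
      by_contra hcon
      push Not at hcon
      have h1 := a1 (ttil + ρ) ⟨by linarith, hcon.le⟩
      have h2 := hth.2 (⟨by linarith, le_antisymm h1 hz1⟩ : τ < ttil + ρ ∧ Z ε (ttil + ρ) = 0)
      linarith
    exact ⟨hth.1.1, hth.1.2, hthle, hsge, a2, a1,
      htrack ε (X ε) (Y ε) (Z ε) (th ε) hε (hX ε hε) (hY ε hε) (hZ ε hε) i1 i2 i3
        (by linarith) a1⟩
  -- avoidance of intervals where xa is negative
  have avoid : ∀ a b : ℝ, (∀ t ∈ Icc a b, xa t < 0) → ∃ ε₀ > (0 : ℝ), ∀ ε : ℝ, 0 < ε → ε < ε₀ →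
      IsLeast {t | τ < t ∧ Z ε t = 0} (th ε) →
      IsLeast (insert Tr {t | (ttil + ρ ≤ t ∧ t ≤ Tr) ∧ Z ε t ≤ 0}) (s ε) →
      s ε < Tr → Z ε (s ε) = 0 → th ε ∉ Icc a b := by
    intro a b hab
    obtain ⟨c, hc, hcb⟩ := aux_negbound hxac a b hab
    refine ⟨c / C, by positivity, ?_⟩
    intro ε hε hlt hth hs hsT hZs hmem
    obtain ⟨b1, b2, b3, b4, b5, b6, b7⟩ := base ε hε hth hs hsT hZs
    have h1 := (abs_le.1 (b7 (th ε) ⟨b1.le, le_rfl⟩).2.1).2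
    have h2 := hcb _ hmem
    rw [lt_div_iff₀ hC] at hlt
    linarith
  -- the core claim
  have core : ∀ η > (0 : ℝ), ∃ ε₀ > (0 : ℝ), ∀ ε : ℝ, 0 < ε → ε < ε₀ →
      IsLeast {t | τ < t ∧ Z ε t = 0} (th ε) →
      IsLeast (insert Tr {t | (ttil + ρ ≤ t ∧ t ≤ Tr) ∧ Z ε t ≤ 0}) (s ε) →
      s ε < Tr → Z ε (s ε) = 0 → |th ε - ttil| ≤ η ∧ ya ttil = 0 := by
    intro η hη
    by_cases hx : xa ttil < 0
    · -- vacuous case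
      have hy : ya ttil = 0 := by
        rcases hR with h | h
        · linarith [h.1]
        · exact h.2
      have hafter := aux_after hM hlam hbound hLipf hf000 hyf hgpos hρδ hxa hya hx.le hy
      obtain ⟨ε₀, h0, hav⟩ := avoid τ (ttil + ρ) (by
        intro t ht
        rcases lt_trichotomy t ttil with h | h | h
        · exact hxaneg t ht.1 h
        · rw [h]; exact hx
        · exact hafter t h ht.2)
      refine ⟨ε₀, h0, fun ε hε hlt hth hs hsT hZs => ?_⟩
      obtain ⟨b1, b2, b3, b4, b5, b6, b7⟩ := base ε hε hth hs hsT hZs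
      exact absurd ⟨b1.le, b3⟩ (hav ε hε hlt hth hs hsT hZs)
    have hx0 : xa ttil = 0 := by
      rcases hR with h | h
      · exact h.1
      · exact le_antisymm h.1 (not_lt.1 hx)
    by_cases hy : ya ttil = 0
    · have hafter := aux_after hM hlam hbound hLipf hf000 hyf hgpos hρδ hxa hya hx0.le hy
      obtain ⟨ε₁, h1, hav1⟩ := avoid τ (ttil - η) (fun t ht => hxaneg t ht.1 (by linarith [ht.2]))
      obtain ⟨ε₂, h2, hav2⟩ := avoid (ttil + η) (ttil + ρ)
        (fun t ht => hafter t (by linarith [ht.1]) ht.2)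
      refine ⟨min ε₁ ε₂, lt_min h1 h2, fun ε hε hlt hth hs hsT hZs => ⟨?_, hy⟩⟩
      obtain ⟨b1, b2, b3, b4, b5, b6, b7⟩ := base ε hε hth hs hsT hZs
      have c1 := hav1 ε hε (hlt.trans_le (min_le_left _ _)) hth hs hsT hZs
      have c2 := hav2 ε hε (hlt.trans_le (min_le_right _ _)) hth hs hsT hZs
      rw [abs_le]
      constructor
      · by_contra h
        exact c1 ⟨b1.le, by linarith [not_le.1 h]⟩
      · by_contra h
        exact c2 ⟨by linarith [not_le.1 h], b3⟩
    · -- transversal crossing: vacuous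
      have hyneg : ya ttil < 0 := by
        rcases hR with h | h
        · exact lt_of_le_of_ne h.2 hy
        · exact absurd h.2 hy
      obtain ⟨p, hpf⟩ : ∃ p, p = f 0 (ya ttil) 0 := ⟨_, rfl⟩
      have hp : 0 < p := by
        have := hyf _ hy
        rw [← hpf] at this
        nlinarith
      obtain ⟨r, hr, hrp⟩ : ∃ r > 0, lam * (3 * r) ≤ p / 2 := by
        refine ⟨p / (6 * (lam + 1)), by positivity, ?_⟩
        have : lam * (3 * (p / (6 * (lam + 1)))) = (lam / (lam + 1)) * (p / 2) := by
          field_simp; ring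
        rw [this]
        have h1 : lam / (lam + 1) ≤ 1 := by rw [div_le_one (by positivity)]; linarith
        nlinarith
      obtain ⟨κ, hκ, hMκ, hκρ⟩ : ∃ κ > 0, M * κ ≤ r / 2 ∧ κ ≤ ρ / 2 := by
        refine ⟨min (r / (2 * M)) (ρ / 2), by positivity, ?_, min_le_right _ _⟩
        calc M * min (r / (2 * M)) (ρ / 2) ≤ M * (r / (2 * M)) :=
              mul_le_mul_of_nonneg_left (min_le_left _ _) hM.le
          _ = r / 2 := by field_simp
      obtain ⟨μ, hμ, hMμ, hμρ⟩ : ∃ μ > 0, M * μ ≤ r / 4 ∧ μ ≤ ρ / 2 := by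
        refine ⟨min (r / (4 * M)) (ρ / 2), by positivity, ?_, min_le_right _ _⟩
        calc M * min (r / (4 * M)) (ρ / 2) ≤ M * (r / (4 * M)) :=
              mul_le_mul_of_nonneg_left (min_le_left _ _) hM.le
          _ = r / 4 := by field_simp
      have hder : HasDerivAt xa p ttil := by
        have := hxa ttil
        rwa [hx0, ← hpf] at this
      obtain ⟨t2, ht2a, ht2b, hxt2⟩ := aux_right hder hp hμ
      rw [hx0] at hxt2
      obtain ⟨ε₁, h1, hav1⟩ := avoid τ (ttil - μ) (fun t ht => hxaneg t ht.1 (by linarith [ht.2]))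
      refine ⟨min (min ε₁ (xa t2 / (C + M))) (min (r / (4 * (C + M))) (p * κ ^ 2 / (4 * r))),
        by positivity, fun ε hε hlt hth hs hsT hZs => ?_⟩
      exfalso
      obtain ⟨b1, b2, b3, b4, b5, b6, b7⟩ := base ε hε hth hs hsT hZs
      rw [lt_min_iff, lt_min_iff, lt_min_iff, lt_div_iff₀ (by positivity),
        lt_div_iff₀ (by positivity), lt_div_iff₀ (by positivity)] at hlt
      obtain ⟨⟨e1, e2⟩, e3, e4⟩ := hlt
      have c1 := hav1 ε hε e1 hth hs hsT hZs
      have low : ttil - μ < th ε := by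
        by_contra h
        exact c1 ⟨b1.le, not_lt.1 h⟩
      have up : th ε ≤ t2 := by
        by_contra h
        have hm : t2 ∈ Icc τ (th ε) := ⟨by linarith, (not_le.1 h).le⟩
        have d1 := b6 t2 hm
        obtain ⟨d2, d3, -⟩ := b7 t2 hm
        have d4 := (abs_le.1 d3).1
        nlinarith
      obtain ⟨d1, d2, d3⟩ := b7 (th ε) ⟨b1.le, le_rfl⟩
      rw [b2, sub_zero] at d1
      have hCε : 0 < C * ε := by positivity
      have hMε : 0 < M * ε := by positivity
      have hy1 : |Y ε (th ε) - ya ttil| ≤ r / 2 := by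
        have l1 := aux_lip hya (fun t => (hbound _ _ _).2.le) ttil (th ε)
        have l2 : |th ε - ttil| ≤ μ := by rw [abs_le]; constructor <;> linarith
        have l3 : M * |th ε - ttil| ≤ M * μ := mul_le_mul_of_nonneg_left l2 hM.le
        have l4 := abs_sub_le (Y ε (th ε)) (ya (th ε)) (ya ttil)
        linarith
      have := aux_escape hM hlam hbound hLipf hε (hX ε hε) (hY ε hε) (hZ ε hε) hp hpf hr hrp hκ hMκ
        b2 b5 (by linarith) hy1 (by linarith) (by linarith) (s ε) (by linarith)
      linarith
  constructor
  · obtain ⟨ε₀, h0, hc⟩ := core (ρ / 4) (by positivity)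
    refine ⟨ε₀, h0, fun ε hε hlt hth hs hsT hZs => ?_⟩
    obtain ⟨b1, b2, b3, b4, b5, b6, b7⟩ := base ε hε hth hs hsT hZs
    refine ⟨(hc ε hε hlt hth hs hsT hZs).1, b5, ?_⟩
    have := (b7 (th ε) ⟨b1.le, le_rfl⟩).1
    rwa [b2, sub_zero] at this
  · intro η hη
    obtain ⟨ε₀, h0, hc⟩ := core (η / (2 * M)) (by positivity)
    refine ⟨min ε₀ (η / (2 * C)), by positivity, fun ε hε hlt hth hs hsT hZs => ?_⟩
    obtain ⟨b1, b2, b3, b4, b5, b6, b7⟩ := base ε hε hth hs hsT hZs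
    obtain ⟨c1, c2⟩ := hc ε hε (hlt.trans_le (min_le_left _ _)) hth hs hsT hZs
    have e1 := hlt.trans_le (min_le_right _ _)
    rw [lt_div_iff₀ (by positivity)] at e1
    have d3 := (b7 (th ε) ⟨b1.le, le_rfl⟩).2.2
    have l1 := aux_lip hya (fun t => (hbound _ _ _).2.le) ttil (th ε)
    have l3 : M * |th ε - ttil| ≤ M * (η / (2 * M)) := mul_le_mul_of_nonneg_left c1 hM.le
    have l5 : M * (η / (2 * M)) = η / 2 := by field_simp
    have l4 := abs_sub_le (Y ε (th ε)) (ya (th ε)) (ya ttil)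
    rw [c2, sub_zero] at l4
    rw [c2] at l1
    linarith
end

section
/- In the setting described in the context, define t̄_ε = min{t ≤ s_ε : z_ε(ξ) ≥ 0 for all ξ ∈ [t, s_ε]}. Then for every sufficiently small ε > 0 (among those ε for which the stated hypotheses hold) one has |t̄_ε − t̃| ≤ ρ/2 and 0 ≤ x_ε(t̄_ε) ≤ Mε; moreover y_ε(t̄_ε) → 0 as ε → 0 along such ε. -/
theorem cn_barrier {u u' B B' : ℝ → ℝ} {a b : ℝ}
    (hu : ∀ t, HasDerivAt u (u' t) t) (hB : ∀ t, HasDerivAt B (B' t) t)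
    (h0 : u a ≤ B a) (h : ∀ t, a ≤ t → t < b → u t = B t → u' t < B' t) :
    ∀ t, a ≤ t → t ≤ b → u t ≤ B t := by
  intro t h1 h2
  exact image_le_of_deriv_right_lt_deriv_boundary (f := u) (f' := u') (a := a) (b := b)
    (fun x _ => (hu x).continuousAt.continuousWithinAt)
    (fun x _ => (hu x).hasDerivWithinAt) h0 hB (fun x hx => h x hx.1 hx.2) ⟨h1, h2⟩

theorem cn_mvt_lower {u u' : ℝ → ℝ} {a b c : ℝ} (hu : ∀ t, HasDerivAt u (u' t) t)
    (hab : a ≤ b) (h : ∀ t, a < t → t < b → c ≤ u' t) : c * (b - a) ≤ u b - u a := by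
  rcases hab.eq_or_lt with rfl | hab
  · simp
  obtain ⟨ξ, hξ, he⟩ := exists_hasDerivAt_eq_slope u u' hab
    (fun x _ => (hu x).continuousAt.continuousWithinAt) (fun x _ => hu x)
  have := h ξ hξ.1 hξ.2
  rw [he, le_div_iff₀ (by linarith)] at this
  exact this

theorem cn_lip {u u' : ℝ → ℝ} {a b M : ℝ} (hu : ∀ t, HasDerivAt u (u' t) t)
    (hab : a ≤ b) (h : ∀ t, |u' t| < M) : |u b - u a| ≤ M * (b - a) := by
  have h1 := cn_mvt_lower (c := -M) hu hab (fun t _ _ => (abs_lt.1 (h t)).1.le)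
  have h2 := cn_mvt_lower (u := fun t => - u t) (c := -M) (fun t => (hu t).neg) hab
    (fun t _ _ => by have := (abs_lt.1 (h t)).2; linarith)
  rw [abs_le]; constructor <;> linarith

/-- key estimate: before `s`, `z ≥ 0` forces `x + z ≤ M ε`. -/
theorem cn_key {X F Z : ℝ → ℝ} {M ε s : ℝ} (hM : 0 < M) (hε : 0 < ε)
    (hX : ∀ t, HasDerivAt X (F t) t) (hF : ∀ t, |F t| < M)
    (hZ : ∀ t, HasDerivAt Z ((X t + |Z t|) / ε) t) (hs : Z s = 0)
    (t : ℝ) (hts : t < s) (hz : 0 ≤ Z t) : X t + Z t ≤ M * ε := by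
  by_contra! hcon
  have h1 := cn_barrier (u := fun r => -(X r + Z r)) (B := fun _ => -(X t + Z t)) (a := t) (b := s)
    (fun r => ((hX r).add (hZ r)).neg) (fun r => hasDerivAt_const r _) le_rfl (by
      intro r _ _ hr
      have hr' : X r + Z r = X t + Z t := by linarith
      have h2 : M < (X r + |Z r|) / ε := by
        rw [lt_div_iff₀ hε]; linarith [le_abs_self (Z r)]
      have := (abs_lt.1 (hF r)).1
      linarith)
  have h3 := cn_mvt_lower (c := M) hZ hts.le (by
    intro r hr1 hr2
    rw [le_div_iff₀ hε]
    have := h1 r hr1.le hr2.le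
    linarith [le_abs_self (Z r)])
  have : 0 < M * (s - t) := mul_pos hM (by linarith)
  linarith

/-- lower bound for `z - x`. -/
theorem cn_low {X F Z : ℝ → ℝ} {M ε s b η : ℝ} (hM : 0 < M) (hε : 0 < ε)
    (hX : ∀ t, HasDerivAt X (F t) t) (hF : ∀ t, |F t| < M)
    (hZ : ∀ t, HasDerivAt Z ((X t + |Z t|) / ε) t) (hs : Z s = 0)
    (hη : M * ε < η) (hb : X b - Z b ≤ η) : ∀ t, b ≤ t → t ≤ s → X t - Z t ≤ η := by
  refine cn_barrier (u := fun r => X r - Z r) (B := fun _ => η)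
    (fun r => (hX r).sub (hZ r)) (fun r => hasDerivAt_const r _) hb ?_
  intro r _ hrs hr
  rcases le_or_gt 0 (Z r) with hz | hz
  · have := cn_key hM hε hX hF hZ hs r hrs hz
    linarith
  · rw [abs_of_neg hz]
    have h2 : M < (X r + -Z r) / ε := by
      rw [lt_div_iff₀ hε]; linarith
    have := (abs_lt.1 (hF r)).2
    linarith

/-- `x` cannot stay away from zero on the positive side for long. -/
theorem cn_nolong {X F Z : ℝ → ℝ} {M ε s b η c t₁ t₂ : ℝ} (hM : 0 < M) (hε : 0 < ε)
    (hX : ∀ t, HasDerivAt X (F t) t) (hF : ∀ t, |F t| < M)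
    (hZ : ∀ t, HasDerivAt Z ((X t + |Z t|) / ε) t) (hs : Z s = 0)
    (hη : M * ε < η) (hb : X b - Z b ≤ η) (h1 : b ≤ t₁) (h2 : t₁ ≤ t₂) (h3 : t₂ < s)
    (hc : M * ε < c) (hpos : ∀ t, t₁ ≤ t → t ≤ t₂ → c ≤ X t) :
    c * (t₂ - t₁) < η * ε := by
  have hl := cn_low hM hε hX hF hZ hs hη hb t₁ h1 (by linarith)
  have hz : Z t₂ < 0 := by
    by_contra! hz
    have := cn_key hM hε hX hF hZ hs t₂ h3 hz
    linarith [hpos t₂ h2 le_rfl]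
  have h4 := cn_mvt_lower (c := c / ε) hZ h2 (by
    intro t ht1 ht2
    gcongr
    linarith [hpos t ht1.le ht2.le, abs_nonneg (Z t)])
  have h5 := hpos t₁ le_rfl h2
  have hMe : 0 < M * ε := by positivity
  have h6 : c / ε * (t₂ - t₁) < η := by linarith
  rw [div_mul_eq_mul_div, div_lt_iff₀ hε] at h6
  exact h6

/-- crude two-sided bound on `z`. -/
theorem cn_zbound {X F Z : ℝ → ℝ} {M ε s b η t R : ℝ} (hM : 0 < M) (hε : 0 < ε)
    (hX : ∀ t, HasDerivAt X (F t) t) (hF : ∀ t, |F t| < M)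
    (hZ : ∀ t, HasDerivAt Z ((X t + |Z t|) / ε) t) (hs : Z s = 0)
    (hη : M * ε < η) (hb : X b - Z b ≤ η) (h1 : b ≤ t) (h3 : t < s)
    (hR : |X t| ≤ R) : |Z t| ≤ R + η := by
  have hl := cn_low hM hε hX hF hZ hs hη hb t h1 h3.le
  have := abs_le.1 hR
  have hMe : 0 < M * ε := by positivity
  rw [abs_le]; refine ⟨by linarith, ?_⟩
  rcases le_or_gt 0 (Z t) with hz | hz
  · have := cn_key hM hε hX hF hZ hs t h3 hz
    linarith
  · linarith [abs_nonneg (X t)]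

/-- `z ≤ 0` while `x < 0`. -/
theorem cn_znonpos {X Z : ℝ → ℝ} {ε τ b : ℝ} (hε : 0 < ε)
    (hZ : ∀ t, HasDerivAt Z ((X t + |Z t|) / ε) t) (h0 : Z τ = 0)
    (hneg : ∀ t, τ ≤ t → t < b → X t < 0) : ∀ t, τ ≤ t → t ≤ b → Z t ≤ 0 := by
  refine cn_barrier (B := fun _ => 0) hZ (fun r => hasDerivAt_const r _) h0.le ?_
  intro t h1 h2 h3
  rw [h3, abs_zero, add_zero]
  exact div_neg_of_neg_of_pos (hneg t h1 h2) hε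

/-- `z - x` decays. -/
theorem cn_decay {X F Z : ℝ → ℝ} {M ε τ b κ : ℝ} (hM : 0 < M) (hε : 0 < ε) (hκ : 0 < κ)
    (hX : ∀ t, HasDerivAt X (F t) t) (hF : ∀ t, |F t| < M)
    (hZ : ∀ t, HasDerivAt Z ((X t + |Z t|) / ε) t) (h0 : Z τ = 0)
    (hneg : ∀ t, τ ≤ t → t < b → X t < 0) :
    ∀ t, τ + κ ≤ t → t ≤ b → |Z t - X t| ≤ (|X τ| / κ + M) * ε := by
  have hz := cn_znonpos hε hZ h0 hneg
  have hB : ∀ t : ℝ, HasDerivAt (fun t => |X τ| * Real.exp (-(t - τ) / ε) + M * ε)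
      (|X τ| * (Real.exp (-(t - τ) / ε) * (-1 / ε))) t := by
    intro t
    have h1 : HasDerivAt (fun t : ℝ => -(t - τ) / ε) (-1 / ε) t :=
      ((((hasDerivAt_id t).sub_const τ).neg).div_const ε)
    exact (h1.exp.const_mul _).add_const _
  have hMe : 0 < M * ε := by positivity
  have up : ∀ t, τ ≤ t → t ≤ b → Z t - X t ≤ |X τ| * Real.exp (-(t - τ) / ε) + M * ε := by
    refine cn_barrier (u := fun t => Z t - X t) (fun r => (hZ r).sub (hX r)) hB ?_ ?_
    · simp only [h0, sub_self, neg_zero, zero_div, Real.exp_zero]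
      linarith [neg_le_abs (X τ)]
    · intro t h1 h2 h3
      rw [abs_of_nonpos (hz t h1 h2.le)]
      have e1 : (X t + -Z t) / ε = |X τ| * (Real.exp (-(t - τ) / ε) * (-1 / ε)) - M := by
        have : X t + - Z t = -(|X τ| * Real.exp (-(t - τ) / ε) + M * ε) := by linarith
        rw [this]; field_simp
        ring
      rw [e1]
      linarith [(abs_lt.1 (hF t)).1]
  have dn : ∀ t, τ ≤ t → t ≤ b → X t - Z t ≤ |X τ| * Real.exp (-(t - τ) / ε) + M * ε := by
    refine cn_barrier (u := fun t => X t - Z t) (fun r => (hX r).sub (hZ r)) hB ?_ ?_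
    · simp only [h0, sub_self, neg_zero, zero_div, Real.exp_zero]
      linarith [le_abs_self (X τ)]
    · intro t h1 h2 h3
      rw [abs_of_nonpos (hz t h1 h2.le)]
      have e1 : (X t + -Z t) / ε = -(|X τ| * (Real.exp (-(t - τ) / ε) * (-1 / ε))) + M := by
        have : X t + - Z t = (|X τ| * Real.exp (-(t - τ) / ε) + M * ε) := by linarith
        rw [this]; field_simp
        try ring
      rw [e1]
      linarith [(abs_lt.1 (hF t)).2]
  intro t h1 h2
  have hexp : Real.exp (-(t - τ) / ε) ≤ ε / κ := by
    have h4 : -(t - τ) / ε ≤ -(κ / ε) := by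
      rw [← neg_div]; gcongr; linarith
    refine (Real.exp_le_exp.2 h4).trans ?_
    rw [Real.exp_neg]
    have h5 := Real.add_one_le_exp (κ / ε)
    have h6 : κ / ε ≤ Real.exp (κ / ε) := by linarith
    have h7 : 0 < κ / ε := by positivity
    calc (Real.exp (κ / ε))⁻¹ ≤ (κ / ε)⁻¹ := inv_anti₀ h7 h6
      _ = ε / κ := inv_div _ _
  have h8 : |X τ| * Real.exp (-(t - τ) / ε) + M * ε ≤ (|X τ| / κ + M) * ε := by
    have := mul_le_mul_of_nonneg_left hexp (abs_nonneg (X τ))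
    calc _ ≤ |X τ| * (ε / κ) + M * ε := by linarith
      _ = _ := by ring
  rw [abs_le]
  constructor
  · linarith [dn t (by linarith) h2]
  · linarith [up t (by linarith) h2]

/-- comparison with the reduced system. -/
theorem cn_gron {f g : ℝ → ℝ → ℝ → ℝ} {lam E d a b : ℝ} (hlam : 0 ≤ lam) (hE : 0 ≤ E) (hd : 0 ≤ d)
    (hLipf : ∀ x₁ y₁ z₁ x₂ y₂ z₂ : ℝ,
      |f x₁ y₁ z₁ - f x₂ y₂ z₂| ≤ lam * (|x₁ - x₂| + |y₁ - y₂| + |z₁ - z₂|))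
    (hLipg : ∀ x₁ y₁ z₁ x₂ y₂ z₂ : ℝ,
      |g x₁ y₁ z₁ - g x₂ y₂ z₂| ≤ lam * (|x₁ - x₂| + |y₁ - y₂| + |z₁ - z₂|))
    {xa ya X Y Z : ℝ → ℝ}
    (hxa : ∀ t : ℝ, HasDerivAt xa (f (xa t) (ya t) (xa t)) t)
    (hya : ∀ t : ℝ, HasDerivAt ya (g (xa t) (ya t) (xa t)) t)
    (hX : ∀ t : ℝ, HasDerivAt X (f (X t) (Y t) (Z t)) t)
    (hY : ∀ t : ℝ, HasDerivAt Y (g (X t) (Y t) (Z t)) t)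
    (hZX : ∀ t, a ≤ t → t ≤ b → |Z t - X t| ≤ E)
    (hxd : |X a - xa a| ≤ d) (hyd : |Y a - ya a| ≤ d) :
    ∀ t, a ≤ t → t ≤ b →
      |X t - xa t| ≤ (d + lam * E) * Real.exp ((3 * lam + 1) * (t - a)) ∧
      |Y t - ya t| ≤ (d + lam * E) * Real.exp ((3 * lam + 1) * (t - a)) := by
  have hK0 : 0 ≤ 3 * lam + 1 := by linarith
  set v : ℝ → ℝ × ℝ → ℝ × ℝ := fun _ p => (f p.1 p.2 p.1, g p.1 p.2 p.1) with hv
  have hlip : ∀ t, LipschitzWith ⟨3 * lam + 1, hK0⟩ (v t) := by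
    intro t
    apply LipschitzWith.of_dist_le_mul
    intro p q
    have h1 : |p.1 - q.1| ≤ dist p q := by
      rw [Prod.dist_eq, ← Real.dist_eq]; exact le_max_left _ _
    have h2 : |p.2 - q.2| ≤ dist p q := by
      rw [Prod.dist_eq, ← Real.dist_eq]; exact le_max_right _ _
    have h3 : lam * (|p.1 - q.1| + |p.2 - q.2| + |p.1 - q.1|) ≤ (3 * lam + 1) * dist p q := by
      have := mul_le_mul_of_nonneg_left (by linarith :
        |p.1 - q.1| + |p.2 - q.2| + |p.1 - q.1| ≤ 3 * dist p q) hlam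
      have := dist_nonneg (x := p) (y := q)
      linarith
    rw [Prod.dist_eq (x := v t p)]
    exact max_le ((hLipf _ _ _ _ _ _).trans h3) ((hLipg _ _ _ _ _ _).trans h3)
  have main := dist_le_of_approx_trajectories_ODE (v := v) (K := ⟨3 * lam + 1, hK0⟩)
    (f := fun t => (X t, Y t)) (g := fun t => (xa t, ya t))
    (f' := fun t => (f (X t) (Y t) (Z t), g (X t) (Y t) (Z t)))
    (g' := fun t => (f (xa t) (ya t) (xa t), g (xa t) (ya t) (xa t)))
    (a := a) (b := b) (εf := lam * E) (εg := 0) (δ := d) hlip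
    (fun t _ => ((hX t).prodMk (hY t)).continuousAt.continuousWithinAt)
    (fun t _ => ((hX t).prodMk (hY t)).hasDerivWithinAt)
    (by
      intro t ht
      have h0 := mul_le_mul_of_nonneg_left (hZX t ht.1 ht.2.le) hlam
      rw [Prod.dist_eq]
      refine max_le ((hLipf _ _ _ _ _ _).trans ?_) ((hLipg _ _ _ _ _ _).trans ?_) <;> simpa using h0)
    (fun t _ => ((hxa t).prodMk (hya t)).continuousAt.continuousWithinAt)
    (fun t _ => ((hxa t).prodMk (hya t)).hasDerivWithinAt)
    (by intro t ht; simp [hv])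
    (by rw [Prod.dist_eq]; exact max_le hxd hyd)
  intro t h1 h2
  have h3 := main t ⟨h1, h2⟩
  have h4 : gronwallBound d ((⟨3 * lam + 1, hK0⟩ : NNReal) : ℝ) (lam * E + 0) (t - a)
      ≤ (d + lam * E) * Real.exp ((3 * lam + 1) * (t - a)) := by
    change gronwallBound d (3 * lam + 1) (lam * E + 0) (t - a) ≤ _
    rw [gronwallBound_of_K_ne_0 (by linarith)]
    have hE' : 0 ≤ lam * E := by positivity
    have h5 : (lam * E + 0) / (3 * lam + 1) ≤ lam * E := by
      rw [add_zero]; exact div_le_self hE' (by linarith)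
    have h6 : 1 ≤ Real.exp ((3 * lam + 1) * (t - a)) :=
      Real.one_le_exp (mul_nonneg hK0 (by linarith))
    have h7 := mul_le_mul_of_nonneg_right h5 (by linarith :
      0 ≤ Real.exp ((3 * lam + 1) * (t - a)) - 1)
    simp only
    nlinarith
  have h5 := h3.trans h4
  rw [Prod.dist_eq] at h5
  exact ⟨(le_max_left _ _).trans h5, (le_max_right _ _).trans h5⟩

theorem cn_small (C : ℝ) {η : ℝ} (hη : 0 < η) : ∀ᶠ ε in nhdsWithin (0 : ℝ) (Set.Ioi 0), C * ε < η := by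
  have h : Filter.Tendsto (fun ε : ℝ => C * ε) (nhdsWithin (0 : ℝ) (Set.Ioi 0)) (nhds (C * 0)) :=
    ((continuous_const.mul continuous_id).tendsto 0).mono_left nhdsWithin_le_nhds
  rw [mul_zero] at h
  exact h.eventually_lt_const hη

structure CNData (M lam τ x₀ y₀ : ℝ) (f g : ℝ → ℝ → ℝ → ℝ) (xa ya : ℝ → ℝ)
    (X Y Z : ℝ → ℝ → ℝ) : Prop where
  hM : 0 < M
  hlam : 0 ≤ lam
  hbf : ∀ x y z : ℝ, |f x y z| < M
  hbg : ∀ x y z : ℝ, |g x y z| < M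
  hLipf : ∀ x₁ y₁ z₁ x₂ y₂ z₂ : ℝ,
      |f x₁ y₁ z₁ - f x₂ y₂ z₂| ≤ lam * (|x₁ - x₂| + |y₁ - y₂| + |z₁ - z₂|)
  hLipg : ∀ x₁ y₁ z₁ x₂ y₂ z₂ : ℝ,
      |g x₁ y₁ z₁ - g x₂ y₂ z₂| ≤ lam * (|x₁ - x₂| + |y₁ - y₂| + |z₁ - z₂|)
  hxa : ∀ t : ℝ, HasDerivAt xa (f (xa t) (ya t) (xa t)) t
  hya : ∀ t : ℝ, HasDerivAt ya (g (xa t) (ya t) (xa t)) t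
  hxaτ : xa τ = x₀
  hyaτ : ya τ = y₀
  hX : ∀ ε : ℝ, 0 < ε → ∀ t : ℝ, HasDerivAt (X ε) (f (X ε t) (Y ε t) (Z ε t)) t
  hY : ∀ ε : ℝ, 0 < ε → ∀ t : ℝ, HasDerivAt (Y ε) (g (X ε t) (Y ε t) (Z ε t)) t
  hZ : ∀ ε : ℝ, 0 < ε → ∀ t : ℝ, HasDerivAt (Z ε) ((X ε t + |Z ε t|) / ε) t
  hIC : ∀ ε : ℝ, 0 < ε → X ε τ = x₀ ∧ Y ε τ = y₀ ∧ Z ε τ = 0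

theorem cn_phase1 {M lam τ x₀ y₀ : ℝ} {f g : ℝ → ℝ → ℝ → ℝ} {xa ya : ℝ → ℝ}
    {X Y Z : ℝ → ℝ → ℝ} (H : CNData M lam τ x₀ y₀ f g xa ya X Y Z) {b : ℝ} (hb : τ < b)
    (hneg : ∀ t, τ ≤ t → t ≤ b → xa t < 0) {η₀ : ℝ} (hη₀ : 0 < η₀) :
    ∀ᶠ ε in nhdsWithin (0 : ℝ) (Set.Ioi 0), |X ε b - xa b| ≤ η₀ ∧ |Y ε b - ya b| ≤ η₀ ∧
      |Z ε b - X ε b| ≤ η₀ ∧ Z ε b < 0 := by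
  have hM := H.hM
  have hlam := H.hlam
  have hcont : Continuous xa := continuous_iff_continuousAt.2 fun t => (H.hxa t).continuousAt
  obtain ⟨tm, htm, hmax⟩ := isCompact_Icc.exists_isMaxOn (Set.nonempty_Icc.2 hb.le)
    hcont.continuousOn (s := Set.Icc τ b)
  set m := - xa tm with hm
  have hmpos : 0 < m := by have := hneg tm htm.1 htm.2; linarith
  have hmle : ∀ t, τ ≤ t → t ≤ b → xa t ≤ -m := by
    intro t h1 h2
    have : xa t ≤ xa tm := hmax (⟨h1, h2⟩ : t ∈ Set.Icc τ b)
    linarith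
  set η := min η₀ (m / 4) with hηdef
  have hη : 0 < η := lt_min hη₀ (by linarith)
  have hηm : η ≤ m / 4 := min_le_right _ _
  have hηη : η ≤ η₀ := min_le_left _ _
  set G := Real.exp ((3 * lam + 1) * (b - τ)) with hG
  have hGpos : 0 < G := Real.exp_pos _
  have hG1 : 1 ≤ G := Real.one_le_exp (mul_nonneg (by linarith) (by linarith))
  set κ := min ((b - τ) / 2) (η / (4 * M * G)) with hκdef
  have hκ : 0 < κ := lt_min (by linarith) (by positivity)
  have hκb : τ + κ < b := by
    have : κ ≤ (b - τ) / 2 := min_le_left _ _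
    linarith
  have hκη : 2 * M * κ * G ≤ η / 2 := by
    have : κ ≤ η / (4 * M * G) := min_le_right _ _
    rw [le_div_iff₀ (by positivity)] at this
    linarith
  filter_upwards [self_mem_nhdsWithin, cn_small (|x₀| / κ + M) hη,
    cn_small (lam * (|x₀| / κ + M) * G) (half_pos hη)] with ε hε hs1 hs2
  have hε : 0 < ε := hε
  obtain ⟨hX0, hY0, hZ0⟩ := H.hIC ε hε
  have hcX : Continuous (X ε) := continuous_iff_continuousAt.2 fun t => (H.hX ε hε t).continuousAt
  -- conditional estimate
  have early : ∀ t, τ ≤ t → t ≤ τ + κ → |X ε t - xa t| ≤ 2 * M * κ ∧ |Y ε t - ya t| ≤ 2 * M * κ := by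
    intro t h1 h2
    have a1 := cn_lip (H.hX ε hε) h1 (fun t => H.hbf _ _ _)
    have a2 := cn_lip (H.hxa) h1 (fun t => H.hbf _ _ _)
    have a3 := cn_lip (H.hY ε hε) h1 (fun t => H.hbg _ _ _)
    have a4 := cn_lip (H.hya) h1 (fun t => H.hbg _ _ _)
    have h5 : M * (t - τ) ≤ M * κ := mul_le_mul_of_nonneg_left (by linarith) hM.le
    rw [hX0] at a1; rw [H.hxaτ] at a2; rw [hY0] at a3; rw [H.hyaτ] at a4
    rw [abs_le] at *
    rw [abs_le]
    refine ⟨⟨?_, ?_⟩, ?_, ?_⟩ <;> linarith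
  have est : ∀ t₁, τ ≤ t₁ → t₁ ≤ b → (∀ t, τ ≤ t → t < t₁ → X ε t < 0) →
      |X ε t₁ - xa t₁| ≤ η ∧ |Y ε t₁ - ya t₁| ≤ η ∧ (τ + κ ≤ t₁ → |Z ε t₁ - X ε t₁| ≤ η) := by
    intro t₁ h1 h2 h3
    have hdec := cn_decay hM hε hκ (H.hX ε hε) (fun t => H.hbf _ _ _) (H.hZ ε hε) hZ0 h3
    rw [hX0] at hdec
    rcases le_total t₁ (τ + κ) with h4 | h4
    · have h5 := early t₁ h1 h4
      have h6 : 2 * M * κ ≤ 2 * M * κ * G := le_mul_of_one_le_right (by positivity) hG1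
      refine ⟨by linarith [h5.1], by linarith [h5.2], fun h => ?_⟩
      exact (hdec t₁ h le_rfl).trans hs1.le
    · have h5 := early (τ + κ) (by linarith) le_rfl
      have hE : 0 ≤ (|x₀| / κ + M) * ε := by positivity
      have h6 := cn_gron hlam hE (by positivity) H.hLipf H.hLipg H.hxa H.hya (H.hX ε hε)
        (H.hY ε hε) hdec h5.1 h5.2 t₁ h4 le_rfl
      have h7 : (2 * M * κ + lam * ((|x₀| / κ + M) * ε)) *
          Real.exp ((3 * lam + 1) * (t₁ - (τ + κ))) ≤ η := by
        have h8 : Real.exp ((3 * lam + 1) * (t₁ - (τ + κ))) ≤ G := by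
          rw [hG]; apply Real.exp_le_exp.2
          exact mul_le_mul_of_nonneg_left (by linarith) (by linarith)
        have h9 := mul_le_mul_of_nonneg_left h8 (by positivity :
          0 ≤ 2 * M * κ + lam * ((|x₀| / κ + M) * ε))
        have : (2 * M * κ + lam * ((|x₀| / κ + M) * ε)) * G =
          2 * M * κ * G + lam * (|x₀| / κ + M) * G * ε := by ring
        linarith
      exact ⟨h6.1.trans h7, h6.2.trans h7, fun h => (hdec t₁ h le_rfl).trans hs1.le⟩
  have hXneg : ∀ t, τ ≤ t → t ≤ b → X ε t < 0 := by
    by_contra! hcon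
    obtain ⟨t0, h1, h2, h3⟩ := hcon
    have hcomp : IsCompact (Set.Icc τ b ∩ {t | 0 ≤ X ε t}) :=
      isCompact_Icc.inter_right (isClosed_le continuous_const hcX)
    obtain ⟨t₁, ⟨⟨h4, h5⟩, h6⟩, h7⟩ := hcomp.exists_isLeast ⟨t0, ⟨h1, h2⟩, h3⟩
    have h8 := est t₁ h4 h5 (by
      intro t g1 g2
      by_contra! g3
      have := h7 ⟨⟨g1, by linarith⟩, g3⟩
      linarith)
    have h9 := (abs_le.1 h8.1).2
    have := hmle t₁ h4 h5
    have h6' : 0 ≤ X ε t₁ := h6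
    linarith
  obtain ⟨e1, e2, e3⟩ := est b hb.le le_rfl (fun t g1 g2 => hXneg t g1 g2.le)
  have e3 := e3 hκb.le
  refine ⟨e1.trans hηη, e2.trans hηη, e3.trans hηη, ?_⟩
  have := hmle b hb.le le_rfl
  have := (abs_le.1 e1).2
  have := (abs_le.1 e3).2
  linarith

theorem cn_phase1' {M lam τ x₀ y₀ ttil : ℝ} {f g : ℝ → ℝ → ℝ → ℝ} {xa ya : ℝ → ℝ}
    {X Y Z : ℝ → ℝ → ℝ} (H : CNData M lam τ x₀ y₀ f g xa ya X Y Z) (hb : τ < ttil)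
    (hneg : ∀ t, τ ≤ t → t < ttil → xa t < 0) (h0 : xa ttil = 0) {η : ℝ} (hη : 0 < η) :
    ∃ b, b < ttil ∧ ttil - η ≤ b ∧
    ∀ᶠ ε in nhdsWithin (0 : ℝ) (Set.Ioi 0), |X ε b| ≤ η ∧ |Y ε b - ya ttil| ≤ η ∧
      X ε b - Z ε b ≤ η ∧ Z ε b < 0 := by
  have hM := H.hM
  set κ := min ((ttil - τ) / 2) (min η (η / (2 * M))) with hκ
  have hκ0 : 0 < κ := lt_min (by linarith) (lt_min hη (by positivity))
  have k1 : κ ≤ (ttil - τ) / 2 := min_le_left _ _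
  have k2 : κ ≤ η := (min_le_right _ _).trans (min_le_left _ _)
  have k3 : κ ≤ η / (2 * M) := (min_le_right _ _).trans (min_le_right _ _)
  rw [le_div_iff₀ (by positivity)] at k3
  refine ⟨ttil - κ, by linarith, by linarith, ?_⟩
  filter_upwards [cn_phase1 H (b := ttil - κ) (by linarith)
    (fun t g1 g2 => hneg t g1 (by linarith)) (half_pos hη)] with ε ⟨e1, e2, e3, e4⟩
  have a2 := cn_lip (H.hxa) (by linarith : ttil - κ ≤ ttil) (fun t => H.hbf _ _ _)
  have a4 := cn_lip (H.hya) (by linarith : ttil - κ ≤ ttil) (fun t => H.hbg _ _ _)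
  rw [h0] at a2
  rw [abs_le] at *
  rw [abs_le]
  refine ⟨⟨?_, ?_⟩, ⟨?_, ?_⟩, ?_, e4⟩ <;> linarith

theorem cn_left {u : ℝ → ℝ} {d t : ℝ} (hu : HasDerivAt u d t)
    (h : 0 < u t ∨ (u t = 0 ∧ d < 0)) : ∃ t' < t, ∀ r, t' ≤ r → r ≤ t → 0 ≤ u r := by
  have key : ∀ᶠ r in nhdsWithin t (Set.Iio t), 0 ≤ u r := by
    rcases h with h | ⟨h, hd⟩
    · have h1 : ∀ᶠ r in nhds t, 0 < u r := hu.continuousAt.eventually_const_lt h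
      exact (h1.filter_mono nhdsWithin_le_nhds).mono fun r hr => hr.le
    · have h1 := hasDerivAt_iff_tendsto_slope.1 hu
      have h2 : ∀ᶠ r in nhdsWithin t (Set.Iio t), slope u t r < 0 :=
        (h1.eventually_lt_const hd).filter_mono (nhdsWithin_mono _ (fun r hr => ne_of_lt hr))
      filter_upwards [h2, self_mem_nhdsWithin] with r hr hrt
      have hrt : r < t := hrt
      rw [slope_def_field, h, sub_zero] at hr
      by_contra! hn
      have : 0 < u r / (r - t) := div_pos_of_neg_of_neg hn (by linarith)
      linarith
  obtain ⟨l, hl, hsub⟩ := (mem_nhdsLT_iff_exists_Ioo_subset).1 key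
  have hl : l < t := hl
  refine ⟨(l + t) / 2, by linarith, fun r h1 h2 => ?_⟩
  rcases h2.eq_or_lt with rfl | h2
  · rcases h with h | h
    · exact h.le
    · exact h.1.ge
  · exact hsub ⟨by linarith, h2⟩

/-- the case `x_a(t̃) < 0` : `x_a` stays negative. -/
theorem cn_caseA {M δ ρ ttil : ℝ} {f g : ℝ → ℝ → ℝ → ℝ} {xa ya : ℝ → ℝ}
    (hM : 0 < M) (hbf : ∀ x y z : ℝ, |f x y z| < M) (hbg : ∀ x y z : ℝ, |g x y z| < M)
    (hxa : ∀ t : ℝ, HasDerivAt xa (f (xa t) (ya t) (xa t)) t)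
    (hya : ∀ t : ℝ, HasDerivAt ya (g (xa t) (ya t) (xa t)) t)
    (hyf : ∀ y : ℝ, y ≠ 0 → y * f 0 y 0 < 0)
    (hgpos : ∀ x y z : ℝ, |x| ≤ δ → |y| ≤ δ → |z| ≤ δ → 0 < g x y z)
    (hρδ : M * ρ ≤ δ) (hx : xa ttil < 0) (hy : ya ttil = 0) :
    ∀ t, ttil ≤ t → t ≤ ttil + ρ → xa t < 0 := by
  by_contra! hcon
  obtain ⟨t0, h1, h2, h3⟩ := hcon
  have hcX : Continuous xa := continuous_iff_continuousAt.2 fun t => (hxa t).continuousAt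
  have hcomp : IsCompact (Set.Icc ttil (ttil + ρ) ∩ {t | 0 ≤ xa t}) :=
    isCompact_Icc.inter_right (isClosed_le continuous_const hcX)
  obtain ⟨t₁, ⟨⟨h4, h5⟩, h6⟩, h7⟩ := hcomp.exists_isLeast ⟨t0, ⟨h1, h2⟩, h3⟩
  have h6 : 0 ≤ xa t₁ := h6
  have hlt : ttil < t₁ := by
    rcases h4.eq_or_lt with h | h
    · rw [← h] at h6; linarith
    · exact h
  have hbefore : ∀ t, ttil ≤ t → t < t₁ → xa t < 0 := by
    intro t g1 g2
    by_contra! g3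
    have := h7 ⟨⟨g1, by linarith⟩, g3⟩
    linarith
  have hno : ¬ ∃ t' < t₁, ∀ r, t' ≤ r → r ≤ t₁ → 0 ≤ xa r := by
    rintro ⟨t', g1, g2⟩
    have := g2 (max t' ((ttil + t₁) / 2)) (le_max_left _ _) (max_le g1.le (by linarith))
    have := hbefore (max t' ((ttil + t₁) / 2)) (le_max_of_le_right (by linarith))
      (max_lt g1 (by linarith))
    linarith
  have hz : xa t₁ = 0 := by
    by_contra hne
    exact hno (cn_left (hxa t₁) (Or.inl (lt_of_le_of_ne h6 (Ne.symm hne))))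
  have hypos : 0 < ya t₁ := by
    obtain ⟨ξ, hξ, he⟩ := exists_hasDerivAt_eq_slope ya _ hlt
      (fun x _ => (hya x).continuousAt.continuousWithinAt) (fun x _ => hya x)
    have b1 := cn_lip hxa hξ.2.le (fun t => hbf _ _ _)
    have b2 := cn_lip hya hξ.1.le (fun t => hbg _ _ _)
    rw [hz, zero_sub, abs_neg] at b1
    rw [hy, sub_zero] at b2
    have b3 : M * (t₁ - ξ) ≤ M * ρ := mul_le_mul_of_nonneg_left (by linarith [hξ.1]) hM.le
    have b4 : M * (ξ - ttil) ≤ M * ρ := mul_le_mul_of_nonneg_left (by linarith [hξ.2]) hM.le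
    have hg := hgpos (xa ξ) (ya ξ) (xa ξ) (by linarith) (by linarith) (by linarith)
    rw [he, hy, sub_zero] at hg
    by_contra! hn
    have : ya t₁ / (t₁ - ttil) ≤ 0 := div_nonpos_of_nonpos_of_nonneg hn (by linarith)
    linarith
  have hf : f 0 (ya t₁) 0 < 0 := by
    have := hyf _ hypos.ne'
    by_contra! hn
    have := mul_nonneg hypos.le hn
    linarith
  exact hno (cn_left (hxa t₁) (Or.inr ⟨hz, by rw [hz]; exact hf⟩))

/-- the case `x_a(t̃) = 0`, `y_a(t̃) < 0` is impossible for small `ε`. -/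
theorem cn_caseB {M lam τ x₀ y₀ ttil ρ : ℝ} {f g : ℝ → ℝ → ℝ → ℝ} {xa ya : ℝ → ℝ}
    {X Y Z : ℝ → ℝ → ℝ} (H : CNData M lam τ x₀ y₀ f g xa ya X Y Z) (hb : τ < ttil) (hρ : 0 < ρ)
    (hneg : ∀ t, τ ≤ t → t < ttil → xa t < 0) (h0 : xa ttil = 0)
    (hf : 0 < f 0 (ya ttil) 0) :
    ∀ᶠ ε in nhdsWithin (0 : ℝ) (Set.Ioi 0), ∀ s, ttil + ρ ≤ s → Z ε s = 0 → False := by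
  have hM := H.hM
  have hlam := H.hlam
  set c := f 0 (ya ttil) 0 / 2 with hc
  have hcpos : 0 < c := half_pos hf
  set r := c / (3 * lam + 1) with hr
  have hrpos : 0 < r := by positivity
  have hr3 : lam * (3 * r) ≤ c := by
    have : r * (3 * lam + 1) = c := by rw [hr]; field_simp
    nlinarith
  set a := min ρ (r / (4 * M)) with ha
  have hapos : 0 < a := lt_min hρ (by positivity)
  have haρ : a ≤ ρ := min_le_left _ _
  have haM : M * a ≤ r / 4 := by
    have : a ≤ r / (4 * M) := min_le_right _ _
    rw [le_div_iff₀ (by positivity)] at this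
    linarith
  set η := min (r / 4) (c * a / 4) with hη
  have hηpos : 0 < η := lt_min (by positivity) (by positivity)
  have hη1 : η ≤ r / 4 := min_le_left _ _
  have hη2 : η ≤ c * a / 4 := min_le_right _ _
  obtain ⟨b, hb1, hb2, hev⟩ := cn_phase1' H hb hneg h0 hηpos
  filter_upwards [hev, self_mem_nhdsWithin, cn_small M hηpos,
    cn_small M (by positivity : 0 < c * a / 4),
    cn_small η (by positivity : 0 < c * a / 4 * (a / 2))] with ε ⟨e1, e2, e3, e4⟩ hε s1 s2 s3 s hs hZs
  have hε : 0 < ε := hε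
  have hXε := H.hX ε hε
  have hF : ∀ t, |f (X ε t) (Y ε t) (Z ε t)| < M := fun t => H.hbf _ _ _
  have hZε := H.hZ ε hε
  have hfc : ∀ t, b ≤ t → t ≤ b + a → c ≤ f (X ε t) (Y ε t) (Z ε t) := by
    intro t g1 g2
    have l1 := cn_lip hXε g1 hF
    have l2 := cn_lip (H.hY ε hε) g1 (fun t => H.hbg _ _ _)
    have l3 : M * (t - b) ≤ M * a := mul_le_mul_of_nonneg_left (by linarith) hM.le
    have x1 : |X ε t| ≤ r / 2 := by
      rw [abs_le] at *; constructor <;> linarith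
    have y1 : |Y ε t - ya ttil| ≤ r / 2 := by
      rw [abs_le] at *; constructor <;> linarith
    have z1 := cn_zbound hM hε hXε hF hZε hZs s1 e3 g1 (by linarith) x1
    have l4 := H.hLipf (X ε t) (Y ε t) (Z ε t) 0 (ya ttil) 0
    rw [sub_zero, sub_zero] at l4
    have l5 := mul_le_mul_of_nonneg_left (by linarith :
      |X ε t| + |Y ε t - ya ttil| + |Z ε t| ≤ 3 * r) hlam
    have l6 := (abs_le.1 l4).1
    linarith
  have hlong := cn_nolong (c := c * a / 4) (t₁ := b + a / 2) (t₂ := b + a) hM hε hXε hF hZε hZs s1 e3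
    (by linarith) (by linarith) (by linarith) s2 (by
      intro t g1 g2
      have := cn_mvt_lower (c := c) (a := b) (b := t) hXε (by linarith)
        (fun r k1 k2 => hfc r k1.le (by linarith))
      have h5 : c * (a / 2) ≤ c * (t - b) := mul_le_mul_of_nonneg_left (by linarith) hcpos.le
      have := (abs_le.1 e1).1
      linarith)
  have : b + a - (b + a / 2) = a / 2 := by ring
  rw [this] at hlong
  linarith

theorem cn_gmin {lam δ : ℝ} {g : ℝ → ℝ → ℝ → ℝ} (hδ : 0 < δ)
    (hLipg : ∀ x₁ y₁ z₁ x₂ y₂ z₂ : ℝ,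
      |g x₁ y₁ z₁ - g x₂ y₂ z₂| ≤ lam * (|x₁ - x₂| + |y₁ - y₂| + |z₁ - z₂|)) :
    Continuous (fun p : ℝ × ℝ × ℝ => g p.1 p.2.1 p.2.2) ∧
    ∃ p : ℝ × ℝ × ℝ, (|p.1| ≤ δ ∧ |p.2.1| ≤ δ ∧ |p.2.2| ≤ δ) ∧
      ∀ x y z : ℝ, |x| ≤ δ → |y| ≤ δ → |z| ≤ δ → g p.1 p.2.1 p.2.2 ≤ g x y z := by
  have hc : Continuous (fun p : ℝ × ℝ × ℝ => g p.1 p.2.1 p.2.2) := by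
    rw [continuous_iff_continuousAt]
    intro q
    rw [ContinuousAt, tendsto_iff_dist_tendsto_zero]
    have h1 : Filter.Tendsto (fun p : ℝ × ℝ × ℝ =>
        lam * (|p.1 - q.1| + |p.2.1 - q.2.1| + |p.2.2 - q.2.2|)) (nhds q) (nhds 0) := by
      have : Continuous (fun p : ℝ × ℝ × ℝ =>
        lam * (|p.1 - q.1| + |p.2.1 - q.2.1| + |p.2.2 - q.2.2|)) := by fun_prop
      have h := this.tendsto q
      simpa using h
    exact squeeze_zero (fun _ => dist_nonneg) (fun p => hLipg _ _ _ _ _ _) h1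
  refine ⟨hc, ?_⟩
  obtain ⟨p, hp, hmin⟩ := ((isCompact_Icc (a := -δ) (b := δ)).prod
    ((isCompact_Icc (a := -δ) (b := δ)).prod (isCompact_Icc (a := -δ) (b := δ)))).exists_isMinOn
    ⟨(0, 0, 0), by constructor <;> simp [hδ.le]⟩ hc.continuousOn
  refine ⟨p, ⟨abs_le.2 hp.1, abs_le.2 hp.2.1, abs_le.2 hp.2.2⟩, fun x y z hx hy hz => ?_⟩
  exact hmin (⟨abs_le.1 hx, abs_le.1 hy, abs_le.1 hz⟩ :
    (x, y, z) ∈ Set.Icc (-δ) δ ×ˢ Set.Icc (-δ) δ ×ˢ Set.Icc (-δ) δ)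

/-- main case `x_a(t̃) = y_a(t̃) = 0`. -/
theorem cn_caseC {M lam τ x₀ y₀ ttil ρ δ a : ℝ} {f g : ℝ → ℝ → ℝ → ℝ} {xa ya : ℝ → ℝ}
    {X Y Z : ℝ → ℝ → ℝ} (H : CNData M lam τ x₀ y₀ f g xa ya X Y Z) (hb : τ < ttil) (hρ : 0 < ρ)
    (hδ : 0 < δ) (hyf : ∀ y : ℝ, y ≠ 0 → y * f 0 y 0 < 0)
    (hgpos : ∀ x y z : ℝ, |x| ≤ δ → |y| ≤ δ → |z| ≤ δ → 0 < g x y z)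
    (hρδ : M * ρ < δ / 2)
    (hneg : ∀ t, τ ≤ t → t < ttil → xa t < 0) (h0 : xa ttil = 0) (hy0 : ya ttil = 0)
    (ha : 0 < a) (haρ : a ≤ ρ / 2) :
    ∀ᶠ ε in nhdsWithin (0 : ℝ) (Set.Ioi 0), ∀ s tb, ttil + ρ ≤ s → Z ε s = 0 →
      (∀ ξ, ttil + ρ ≤ ξ → ξ < s → 0 < Z ε ξ) →
      IsLeast {t | t ≤ s ∧ ∀ ξ : ℝ, t ≤ ξ → ξ ≤ s → 0 ≤ Z ε ξ} tb →
      |tb - ttil| ≤ a ∧ 0 ≤ X ε tb ∧ X ε tb ≤ M * ε ∧ |Y ε tb| ≤ a * (1 + 2 * M) := by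
  have hM := H.hM
  have hlam := H.hlam
  obtain ⟨-, p, ⟨hp1, hp2, hp3⟩, hgmin⟩ := cn_gmin hδ H.hLipg
  set c₀ := g p.1 p.2.1 p.2.2 with hc₀
  have hc₀pos : 0 < c₀ := hgpos _ _ _ hp1 hp2 hp3
  set c₁ := c₀ * a / 4 with hc₁
  have hc₁pos : 0 < c₁ := by positivity
  -- uniform negativity of `f(0,y,0)` for `y ∈ [c₁, c₁+δ]`
  obtain ⟨c, hcpos, hc⟩ : ∃ c > 0, ∀ y, c₁ ≤ y → y ≤ c₁ + δ → f 0 y 0 ≤ -(2 * c) := by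
    have hcont : Continuous (fun y : ℝ => f 0 y 0) :=
      (cn_gmin hδ H.hLipf).1.comp (by fun_prop : Continuous (fun y : ℝ => ((0 : ℝ), y, (0 : ℝ))))
    obtain ⟨ym, hym, hmax⟩ := (isCompact_Icc (a := c₁) (b := c₁ + δ)).exists_isMaxOn
      (Set.nonempty_Icc.2 (by linarith)) hcont.continuousOn
    have hympos : 0 < ym := lt_of_lt_of_le hc₁pos hym.1
    have hfn : f 0 ym 0 < 0 := by
      have := hyf _ hympos.ne'
      by_contra! hn
      have := mul_nonneg hympos.le hn
      linarith
    refine ⟨-(f 0 ym 0) / 2, by linarith, fun y g1 g2 => ?_⟩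
    have : f 0 y 0 ≤ f 0 ym 0 := hmax (⟨g1, g2⟩ : y ∈ Set.Icc c₁ (c₁ + δ))
    linarith
  set r := c / (2 * lam + 1) with hr
  have hrpos : 0 < r := by positivity
  have hr3 : lam * (2 * r) ≤ c := by
    have : r * (2 * lam + 1) = c := by rw [hr]; field_simp
    nlinarith
  set c' := min (c / 2) (r / (2 * ρ)) with hc'
  have hc'pos : 0 < c' := lt_min (by positivity) (by positivity)
  have hc'c : c' ≤ c / 2 := min_le_left _ _
  have hc'ρ : c' * ρ ≤ r / 2 := by
    have : c' ≤ r / (2 * ρ) := min_le_right _ _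
    rw [le_div_iff₀ (by positivity)] at this
    linarith
  set c₃ := c' * a / 8 with hc₃
  have hc₃pos : 0 < c₃ := by positivity
  have hc₃r : c₃ ≤ r / 2 := by
    have : c' * a ≤ c' * ρ := mul_le_mul_of_nonneg_left (by linarith) hc'pos.le
    have : 0 < c' * a := by positivity
    linarith
  set D := (δ / 2 - M * ρ) / (2 + M) with hD
  have hDpos : 0 < D := div_pos (by linarith) (by linarith)
  have hDeq : D * (2 + M) = δ / 2 - M * ρ := by rw [hD]; field_simp
  set η := min (min a c₁) (min (r / 2) D) with hη
  have hηpos : 0 < η := lt_min (lt_min ha hc₁pos) (lt_min (by positivity) hDpos)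
  have hη1 : η ≤ a := (min_le_left _ _).trans (min_le_left _ _)
  have hη2 : η ≤ c₁ := (min_le_left _ _).trans (min_le_right _ _)
  have hη3 : η ≤ r / 2 := (min_le_right _ _).trans (min_le_left _ _)
  have hη4 : η ≤ D := (min_le_right _ _).trans (min_le_right _ _)
  have hη5 : 2 * η + M * η ≤ δ / 2 - M * ρ := by
    have := mul_le_mul_of_nonneg_right hη4 (by linarith : 0 ≤ 2 + M)
    linarith
  obtain ⟨b, hb1, hb2, hev⟩ := cn_phase1' H hb hneg h0 hηpos
  filter_upwards [hev, self_mem_nhdsWithin, cn_small M hηpos, cn_small M hc₃pos,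
    cn_small η (by positivity : 0 < c₃ * (a / 4))]
    with ε ⟨e1, e2, e3, e4⟩ hε s1 s2 s3 s tb hs hZs hpos hleast
  have hε : 0 < ε := hε
  have hXε := H.hX ε hε
  have hF : ∀ t, |f (X ε t) (Y ε t) (Z ε t)| < M := fun t => H.hbf _ _ _
  have hZε := H.hZ ε hε
  rw [hy0, sub_zero] at e2
  obtain ⟨⟨htbs, htbZ⟩, htbmin⟩ := hleast
  have htbρ : tb ≤ ttil + ρ := by
    refine htbmin ⟨hs, fun ξ g1 g2 => ?_⟩
    rcases g2.eq_or_lt with rfl | g2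
    · exact hZs.ge
    · exact (hpos ξ g1 g2).le
  have hbtb : b < tb := by
    by_contra! hn
    have := htbZ b hn (by linarith)
    linarith
  have hXtb : 0 ≤ X ε tb := by
    by_contra! hn
    have hz0 := htbZ tb le_rfl htbs
    have hd : 0 < Z ε tb ∨ (Z ε tb = 0 ∧ (X ε tb + |Z ε tb|) / ε < 0) := by
      rcases hz0.eq_or_lt with h | h
      · right
        refine ⟨h.symm, ?_⟩
        rw [← h, abs_zero, add_zero]
        exact div_neg_of_neg_of_pos hn hε
      · exact Or.inl h
    obtain ⟨t', g1, g2⟩ := cn_left (hZε tb) hd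
    have := htbmin (show t' ∈ {t | t ≤ s ∧ ∀ ξ : ℝ, t ≤ ξ → ξ ≤ s → 0 ≤ Z ε ξ} from
      ⟨by linarith, fun ξ k1 k2 => by
        rcases le_total ξ tb with h | h
        · exact g2 ξ k1 h
        · exact htbZ ξ h k2⟩)
    linarith
  have hup : tb ≤ ttil + a := by
    by_contra! hcon
    have hbd : ∀ t, b ≤ t → t < tb → |X ε t| ≤ δ ∧ |Y ε t| ≤ δ ∧ |Z ε t| ≤ δ := by
      intro t g1 g2
      have l1 := cn_lip hXε g1 hF
      have l2 := cn_lip (H.hY ε hε) g1 (fun t => H.hbg _ _ _)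
      have l3 : M * (t - b) ≤ M * (ρ + η) := mul_le_mul_of_nonneg_left (by linarith) hM.le
      have x1 : |X ε t| ≤ δ - η := by
        rw [abs_le] at *; constructor <;> linarith
      have y1 : |Y ε t| ≤ δ := by
        rw [abs_le] at *; constructor <;> linarith
      have z1 := cn_zbound hM hε hXε hF hZε hZs s1 e3 g1 (by linarith) x1
      exact ⟨by linarith, y1, by linarith⟩
    have hYlow : ∀ t, ttil + a / 2 ≤ t → t < tb → c₁ ≤ Y ε t := by
      intro t g1 g2
      have := cn_mvt_lower (c := c₀) (a := b) (b := t) (H.hY ε hε) (by linarith)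
        (fun r k1 k2 => by
          obtain ⟨q1, q2, q3⟩ := hbd r k1.le (by linarith)
          exact hgmin _ _ _ q1 q2 q3)
      have h5 : c₀ * (a / 2) ≤ c₀ * (t - b) := mul_le_mul_of_nonneg_left (by linarith) hc₀pos.le
      have := (abs_le.1 e2).1
      linarith
    have hXlow : ∀ t, ttil + a / 2 ≤ t → t ≤ ttil + 3 * a / 4 → c₃ ≤ X ε t := by
      intro t g1 g2
      by_contra! hn
      have hbar := cn_barrier (u := X ε) (B := fun q => c₃ - c' * (q - t)) (B' := fun _ => -c')
        (a := t) (b := tb) hXε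
        (fun q => by
          have h1 : HasDerivAt (fun q : ℝ => c' * (q - t)) (c' * 1) q :=
            ((hasDerivAt_id q).sub_const t).const_mul c'
          have h2 := h1.const_sub c₃
          rwa [mul_one] at h2)
        (by simpa using hn.le)
        (by
          intro q k1 k2 k3
          have m1 : c' * (q - t) ≤ c' * ρ := mul_le_mul_of_nonneg_left (by linarith) hc'pos.le
          have m2 : 0 ≤ c' * (q - t) := mul_nonneg hc'pos.le (by linarith)
          have x1 : |X ε q| ≤ r / 2 := by
            rw [k3, abs_le]; constructor <;> linarith
          have z1 := cn_zbound hM hε hXε hF hZε hZs s1 e3 (by linarith : b ≤ q) (by linarith) x1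
          have hy1 := hYlow q (by linarith) k2
          have hy2 := (abs_le.1 (hbd q (by linarith) k2).2.1).2
          have hfq := hc (Y ε q) hy1 (by linarith)
          have l4 := H.hLipf (X ε q) (Y ε q) (Z ε q) 0 (Y ε q) 0
          rw [sub_zero, sub_zero, sub_self, abs_zero] at l4
          have l5 := mul_le_mul_of_nonneg_left (by linarith :
            |X ε q| + 0 + |Z ε q| ≤ 2 * r) hlam
          have l6 := (abs_le.1 l4).2
          linarith)
        tb (by linarith) le_rfl
      have h5 : c' * (a / 4) ≤ c' * (tb - t) := mul_le_mul_of_nonneg_left (by linarith) hc'pos.le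
      linarith
    have hlong := cn_nolong (c := c₃) (t₁ := ttil + a / 2) (t₂ := ttil + 3 * a / 4)
      hM hε hXε hF hZε hZs s1 e3 (by linarith) (by linarith) (by linarith) s2 hXlow
    have : ttil + 3 * a / 4 - (ttil + a / 2) = a / 4 := by ring
    rw [this] at hlong
    linarith
  refine ⟨abs_le.2 ⟨by linarith, by linarith⟩, hXtb, ?_, ?_⟩
  · have hz0 := htbZ tb le_rfl htbs
    have := cn_key hM hε hXε hF hZε hZs tb (by linarith) hz0
    linarith
  · have l2 := cn_lip (H.hY ε hε) hbtb.le (fun t => H.hbg _ _ _)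
    have l3 : M * (tb - b) ≤ M * (2 * a) := mul_le_mul_of_nonneg_left (by linarith) hM.le
    rw [abs_le] at *
    constructor <;> linarith

/-- In the canard setting, with
`t̄_ε = min{t ≤ s_ε : z_ε(ξ) ≥ 0 for all ξ ∈ [t, s_ε]}`, for every sufficiently
small `ε > 0` (among those `ε` for which the stated hypotheses hold) one has
`|t̄_ε - t̃| ≤ ρ/2` and `0 ≤ x_ε(t̄_ε) ≤ Mε`; moreover `y_ε(t̄_ε) → 0` as
`ε → 0` along such `ε`. -/
theorem tbar_near_ttilde
    (M lam δ ρ τ ttil Tr x₀ y₀ : ℝ) (hM : 0 < M) (hlam : 0 ≤ lam)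
    (f g : ℝ → ℝ → ℝ → ℝ)
    -- Assumption 1: global boundedness and global Lipschitz continuity
    (hbound : ∀ x y z : ℝ, |f x y z| < M ∧ |g x y z| < M)
    (hLipf : ∀ x₁ y₁ z₁ x₂ y₂ z₂ : ℝ,
      |f x₁ y₁ z₁ - f x₂ y₂ z₂| ≤ lam * (|x₁ - x₂| + |y₁ - y₂| + |z₁ - z₂|))
    (hLipg : ∀ x₁ y₁ z₁ x₂ y₂ z₂ : ℝ,
      |g x₁ y₁ z₁ - g x₂ y₂ z₂| ≤ lam * (|x₁ - x₂| + |y₁ - y₂| + |z₁ - z₂|))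
    -- Assumption 2
    (hf000 : f 0 0 0 = 0) (hg000 : 0 < g 0 0 0)
    (hyf : ∀ y : ℝ, y ≠ 0 → y * f 0 y 0 < 0)
    -- choice of δ and ρ
    (hδ : 0 < δ)
    (hgpos : ∀ x y z : ℝ, |x| ≤ δ → |y| ≤ δ → |z| ≤ δ → 0 < g x y z)
    (hρ : 0 < ρ) (hρδ : ρ < δ / (2 * M))
    -- the time moments
    (hτttil : τ < ttil) (httilTr : ttil < Tr) (httilρ : ttil + ρ < Tr)
    (hx₀ : x₀ < 0)
    -- (x_a, y_a) is the solution of the attractive reduced system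
    (xa ya : ℝ → ℝ)
    (hxa : ∀ t : ℝ, HasDerivAt xa (f (xa t) (ya t) (xa t)) t)
    (hya : ∀ t : ℝ, HasDerivAt ya (g (xa t) (ya t) (xa t)) t)
    (hxaτ : xa τ = x₀) (hyaτ : ya τ = y₀)
    (hxaneg : ∀ t : ℝ, τ ≤ t → t < ttil → xa t < 0)
    -- (x_a(t̃), y_a(t̃)) ∈ R
    (hR : (xa ttil = 0 ∧ ya ttil ≤ 0) ∨ (xa ttil ≤ 0 ∧ ya ttil = 0))
    -- for each ε > 0, (X ε, Y ε, Z ε) is the solution of the slow–fast system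
    (X Y Z : ℝ → ℝ → ℝ)
    (hX : ∀ ε : ℝ, 0 < ε → ∀ t : ℝ,
      HasDerivAt (X ε) (f (X ε t) (Y ε t) (Z ε t)) t)
    (hY : ∀ ε : ℝ, 0 < ε → ∀ t : ℝ,
      HasDerivAt (Y ε) (g (X ε t) (Y ε t) (Z ε t)) t)
    (hZ : ∀ ε : ℝ, 0 < ε → ∀ t : ℝ,
      HasDerivAt (Z ε) ((X ε t + |Z ε t|) / ε) t)
    (hIC : ∀ ε : ℝ, 0 < ε → X ε τ = x₀ ∧ Y ε τ = y₀ ∧ Z ε τ = 0)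
    -- t̂_ε and s_ε
    (th s tb : ℝ → ℝ) :
    (∃ ε₀ > (0 : ℝ), ∀ ε : ℝ, 0 < ε → ε < ε₀ →
      IsLeast {t | τ < t ∧ Z ε t = 0} (th ε) →
      IsLeast (insert Tr {t | (ttil + ρ ≤ t ∧ t ≤ Tr) ∧ Z ε t ≤ 0}) (s ε) →
      s ε < Tr → Z ε (s ε) = 0 →
      IsLeast {t | t ≤ s ε ∧ ∀ ξ : ℝ, t ≤ ξ → ξ ≤ s ε → 0 ≤ Z ε ξ} (tb ε) →
      |tb ε - ttil| ≤ ρ / 2 ∧ 0 ≤ X ε (tb ε) ∧ X ε (tb ε) ≤ M * ε) ∧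
    (∀ η > (0 : ℝ), ∃ ε₁ > (0 : ℝ), ∀ ε : ℝ, 0 < ε → ε < ε₁ →
      IsLeast {t | τ < t ∧ Z ε t = 0} (th ε) →
      IsLeast (insert Tr {t | (ttil + ρ ≤ t ∧ t ≤ Tr) ∧ Z ε t ≤ 0}) (s ε) →
      s ε < Tr → Z ε (s ε) = 0 →
      IsLeast {t | t ≤ s ε ∧ ∀ ξ : ℝ, t ≤ ξ → ξ ≤ s ε → 0 ≤ Z ε ξ} (tb ε) →
      |Y ε (tb ε)| ≤ η) := by
  have hρδ' : M * ρ < δ / 2 := by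
    rw [lt_div_iff₀ (by positivity)] at hρδ
    linarith
  have H : CNData M lam τ x₀ y₀ f g xa ya X Y Z :=
    ⟨hM, hlam, fun x y z => (hbound x y z).1, fun x y z => (hbound x y z).2, hLipf, hLipg,
      hxa, hya, hxaτ, hyaτ, hX, hY, hZ, hIC⟩
  have main : ∀ a : ℝ, 0 < a → a ≤ ρ / 2 → ∃ ε₀ > (0 : ℝ), ∀ ε : ℝ, 0 < ε → ε < ε₀ →
      IsLeast (insert Tr {t | (ttil + ρ ≤ t ∧ t ≤ Tr) ∧ Z ε t ≤ 0}) (s ε) →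
      s ε < Tr → Z ε (s ε) = 0 →
      IsLeast {t | t ≤ s ε ∧ ∀ ξ : ℝ, t ≤ ξ → ξ ≤ s ε → 0 ≤ Z ε ξ} (tb ε) →
      |tb ε - ttil| ≤ a ∧ 0 ≤ X ε (tb ε) ∧ X ε (tb ε) ≤ M * ε ∧
        |Y ε (tb ε)| ≤ a * (1 + 2 * M) := by
    intro a ha haρ
    have hev : ∀ᶠ ε in nhdsWithin (0 : ℝ) (Set.Ioi 0), ∀ s tb, ttil + ρ ≤ s → Z ε s = 0 →
        (∀ ξ, ttil + ρ ≤ ξ → ξ < s → 0 < Z ε ξ) →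
        IsLeast {t | t ≤ s ∧ ∀ ξ : ℝ, t ≤ ξ → ξ ≤ s → 0 ≤ Z ε ξ} tb →
        |tb - ttil| ≤ a ∧ 0 ≤ X ε tb ∧ X ε tb ≤ M * ε ∧ |Y ε tb| ≤ a * (1 + 2 * M) := by
      rcases lt_or_ge (xa ttil) 0 with hneg | hge
      · have hy0 : ya ttil = 0 := by
          rcases hR with h | h
          · exact absurd h.1 hneg.ne
          · exact h.2
        have hA := cn_caseA hM H.hbf H.hbg hxa hya hyf hgpos (by linarith : M * ρ ≤ δ) hneg hy0
        filter_upwards [cn_phase1 H (b := ttil + ρ) (by linarith) (fun t g1 g2 => by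
          rcases lt_or_ge t ttil with h | h
          · exact hxaneg t g1 h
          · exact hA t h g2) one_pos] with ε ⟨_, _, _, e4⟩ s tb hs hZs hpos _
        exfalso
        rcases hs.eq_or_lt with h | h
        · rw [h] at e4; linarith
        · have := hpos (ttil + ρ) le_rfl h
          linarith
      · have hx0 : xa ttil = 0 := by
          rcases hR with h | h
          · exact h.1
          · exact le_antisymm h.1 hge
        have hyle : ya ttil ≤ 0 := by
          rcases hR with h | h
          · exact h.2
          · exact h.2.le
        rcases hyle.eq_or_lt with hy0 | hylt
        · exact cn_caseC H hτttil hρ hδ hyf hgpos hρδ' hxaneg hx0 hy0 ha haρ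
        · have hfpos : 0 < f 0 (ya ttil) 0 := by
            have := hyf _ hylt.ne
            by_contra! hn
            have := mul_nonneg_of_nonpos_of_nonpos hylt.le hn
            linarith
          filter_upwards [cn_caseB H hτttil hρ hxaneg hx0 hfpos] with ε h s tb hs hZs _ _
          exact (h s hs hZs).elim
    obtain ⟨ε₀, hε₀, hsub⟩ := (mem_nhdsGT_iff_exists_Ioo_subset).1 hev
    refine ⟨ε₀, hε₀, fun ε h1 h2 hs hsT hZs hleast => ?_⟩
    have hmem : (ttil + ρ ≤ s ε ∧ s ε ≤ Tr) ∧ Z ε (s ε) ≤ 0 := by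
      rcases hs.1 with h | h
      · exact absurd h hsT.ne
      · exact h
    refine hsub (⟨h1, h2⟩ : ε ∈ Set.Ioo 0 ε₀) (s ε) (tb ε) hmem.1.1 hZs ?_ hleast
    intro ξ g1 g2
    by_contra! hn
    have := hs.2 (Set.mem_insert_of_mem _ ⟨⟨g1, by linarith⟩, hn⟩)
    linarith
  constructor
  · obtain ⟨ε₀, hε₀, h⟩ := main (ρ / 2) (by linarith) le_rfl
    refine ⟨ε₀, hε₀, fun ε h1 h2 _ h4 h5 h6 h7 => ?_⟩
    obtain ⟨k1, k2, k3, _⟩ := h ε h1 h2 h4 h5 h6 h7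
    exact ⟨k1, k2, k3⟩
  · intro η hη
    obtain ⟨ε₀, hε₀, h⟩ := main (min (ρ / 2) (η / (1 + 2 * M)))
      (lt_min (by linarith) (by positivity)) (min_le_left _ _)
    refine ⟨ε₀, hε₀, fun ε h1 h2 _ h4 h5 h6 h7 => ?_⟩
    obtain ⟨_, _, _, k4⟩ := h ε h1 h2 h4 h5 h6 h7
    refine k4.trans ?_
    rw [← le_div_iff₀ (by positivity)]
    exact min_le_right _ _
end

section
/- In the setting described in the context, define t̄_ε = min{t ≤ s_ε : z_ε(ξ) ≥ 0 for all ξ ∈ [t, s_ε]}, let T_a ≤ τ, T = T_r − T_a, and ω = ε ln(T/ε). Then for every sufficiently small ε > 0 (among those ε for which the stated hypotheses hold) one has |z_ε(t) + x_ε(t)| ≤ 2Mε for all t with t̄_ε ≤ t ≤ s_ε − ω. -/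
/-- In the canard setting, with
`t̄_ε = min{t ≤ s_ε : z_ε(ξ) ≥ 0 for all ξ ∈ [t, s_ε]}`, `T_a ≤ τ`,
`T = T_r - T_a` and `ω = ε ln(T/ε)`, for every sufficiently small `ε > 0`
(among those `ε` for which the stated hypotheses hold) one has
`|z_ε(t) + x_ε(t)| ≤ 2Mε` for all `t ∈ [t̄_ε, s_ε - ω]`. -/
theorem z_close_to_minus_x_repulsive
    (M lam δ ρ τ ttil Tr x₀ y₀ : ℝ) (hM : 0 < M) (hlam : 0 ≤ lam)
    (f g : ℝ → ℝ → ℝ → ℝ)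
    -- Assumption 1: global boundedness and global Lipschitz continuity
    (hbound : ∀ x y z : ℝ, |f x y z| < M ∧ |g x y z| < M)
    (hLipf : ∀ x₁ y₁ z₁ x₂ y₂ z₂ : ℝ,
      |f x₁ y₁ z₁ - f x₂ y₂ z₂| ≤ lam * (|x₁ - x₂| + |y₁ - y₂| + |z₁ - z₂|))
    (hLipg : ∀ x₁ y₁ z₁ x₂ y₂ z₂ : ℝ,
      |g x₁ y₁ z₁ - g x₂ y₂ z₂| ≤ lam * (|x₁ - x₂| + |y₁ - y₂| + |z₁ - z₂|))
    -- Assumption 2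
    (hf000 : f 0 0 0 = 0) (hg000 : 0 < g 0 0 0)
    (hyf : ∀ y : ℝ, y ≠ 0 → y * f 0 y 0 < 0)
    -- choice of δ and ρ
    (hδ : 0 < δ)
    (hgpos : ∀ x y z : ℝ, |x| ≤ δ → |y| ≤ δ → |z| ≤ δ → 0 < g x y z)
    (hρ : 0 < ρ) (hρδ : ρ < δ / (2 * M))
    -- the time moments
    (hτttil : τ < ttil) (httilTr : ttil < Tr) (httilρ : ttil + ρ < Tr)
    (hx₀ : x₀ < 0)
    -- T_a ≤ τ and T = T_r - T_a
    (Ta T : ℝ) (hTa : Ta ≤ τ) (hT : T = Tr - Ta)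
    -- (x_a, y_a) is the solution of the attractive reduced system
    (xa ya : ℝ → ℝ)
    (hxa : ∀ t : ℝ, HasDerivAt xa (f (xa t) (ya t) (xa t)) t)
    (hya : ∀ t : ℝ, HasDerivAt ya (g (xa t) (ya t) (xa t)) t)
    (hxaτ : xa τ = x₀) (hyaτ : ya τ = y₀)
    (hxaneg : ∀ t : ℝ, τ ≤ t → t < ttil → xa t < 0)
    -- (x_a(t̃), y_a(t̃)) ∈ R
    (hR : (xa ttil = 0 ∧ ya ttil ≤ 0) ∨ (xa ttil ≤ 0 ∧ ya ttil = 0))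
    -- for each ε > 0, (X ε, Y ε, Z ε) is the solution of the slow–fast system
    (X Y Z : ℝ → ℝ → ℝ)
    (hX : ∀ ε : ℝ, 0 < ε → ∀ t : ℝ,
      HasDerivAt (X ε) (f (X ε t) (Y ε t) (Z ε t)) t)
    (hY : ∀ ε : ℝ, 0 < ε → ∀ t : ℝ,
      HasDerivAt (Y ε) (g (X ε t) (Y ε t) (Z ε t)) t)
    (hZ : ∀ ε : ℝ, 0 < ε → ∀ t : ℝ,
      HasDerivAt (Z ε) ((X ε t + |Z ε t|) / ε) t)
    (hIC : ∀ ε : ℝ, 0 < ε → X ε τ = x₀ ∧ Y ε τ = y₀ ∧ Z ε τ = 0)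
    -- t̂_ε and s_ε
    (th s tb : ℝ → ℝ) :
    ∃ ε₀ > (0 : ℝ), ∀ ε : ℝ, 0 < ε → ε < ε₀ →
      IsLeast {t | τ < t ∧ Z ε t = 0} (th ε) →
      IsLeast (insert Tr {t | (ttil + ρ ≤ t ∧ t ≤ Tr) ∧ Z ε t ≤ 0}) (s ε) →
      s ε < Tr → Z ε (s ε) = 0 →
      IsLeast {t | t ≤ s ε ∧ ∀ ξ : ℝ, t ≤ ξ → ξ ≤ s ε → 0 ≤ Z ε ξ} (tb ε) →
      ∀ t : ℝ, tb ε ≤ t → t ≤ s ε - ε * Real.log (T / ε) →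
        |Z ε t + X ε t| ≤ 2 * M * ε := by
  have hTpos : 0 < T := by linarith
  refine ⟨T, hTpos, ?_⟩
  intro ε hε hεT hth hs hsTr hZs htb t ht1 ht2
  have dX := hX ε hε
  have dZ := hZ ε hε
  obtain ⟨hX0, -, hZ0⟩ := hIC ε hε
  have hlog : 0 < Real.log (T / ε) := Real.log_pos (by rw [lt_div_iff₀ hε]; linarith)
  have hts : t ≤ s ε := by
    have := mul_pos hε hlog
    linarith
  have hs1 : ttil + ρ ≤ s ε := by
    rcases hs.1 with h | h
    · exact absurd h hsTr.ne
    · exact h.1.1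
  have hτs : τ < s ε := by linarith
  have hths : th ε ≤ s ε := hth.2 ⟨hτs, hZs⟩
  obtain ⟨hτth, hZth⟩ := hth.1
  have cX : Continuous (X ε) := continuous_iff_continuousAt.2 fun u => (dX u).continuousAt
  have cZ : Continuous (Z ε) := continuous_iff_continuousAt.2 fun u => (dZ u).continuousAt
  -- X vanishes somewhere in [τ, th]
  have hex : ∃ u ∈ Set.Icc τ (th ε), 0 ≤ X ε u := by
    by_contra hcon
    push Not at hcon
    have hZle : ∀ ⦃u⦄, u ∈ Set.Icc τ (th ε) → Z ε u ≤ 0 := by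
      refine image_le_of_deriv_right_lt_deriv_boundary (B := fun _ => (0:ℝ)) (B' := fun _ => 0)
        cZ.continuousOn (fun u _ => (dZ u).hasDerivWithinAt) hZ0.le
        (fun u => hasDerivAt_const u _) ?_
      intro u hu h0
      have := hcon u ⟨hu.1, hu.2.le⟩
      rw [h0, abs_zero, add_zero]
      exact div_neg_of_neg_of_pos this hε
    have hd : ∀ u, HasDerivAt (fun u => Z ε u * Real.exp (u / ε))
        ((X ε u + |Z ε u|) / ε * Real.exp (u / ε)
          + Z ε u * (Real.exp (u / ε) * (1 / ε))) u := fun u =>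
      (dZ u).mul (((hasDerivAt_id u).div_const ε).exp)
    have hanti : StrictAntiOn (fun u => Z ε u * Real.exp (u / ε)) (Set.Icc τ (th ε)) := by
      refine strictAntiOn_of_deriv_neg (convex_Icc _ _)
        (fun u _ => (hd u).continuousAt.continuousWithinAt) ?_
      intro u hu
      have hu' := interior_subset hu
      rw [(hd u).deriv, abs_of_nonpos (hZle hu')]
      have : (X ε u + -Z ε u) / ε * Real.exp (u / ε) + Z ε u * (Real.exp (u / ε) * (1 / ε))
          = X ε u * (Real.exp (u / ε) / ε) := by ring
      rw [this]
      exact mul_neg_of_neg_of_pos (hcon u hu') (by positivity)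
    have := hanti ⟨le_rfl, hτth.le⟩ ⟨hτth.le, le_rfl⟩ hτth
    simp [hZ0, hZth] at this
  obtain ⟨u, hu, hXu⟩ := hex
  obtain ⟨t0, ht0, hXt0⟩ : (0:ℝ) ∈ X ε '' Set.Icc τ u :=
    intermediate_value_Icc hu.1 cX.continuousOn ⟨by rw [hX0]; exact hx₀.le, hXu⟩
  have hXs : |X ε (s ε)| ≤ M * T := by
    have h := (convex_univ (𝕜 := ℝ) (E := ℝ)).norm_image_sub_le_of_norm_hasDerivWithin_le
      (f := X ε) (C := M) (x := t0) (y := s ε)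
      (fun v _ => (dX v).hasDerivWithinAt)
      (fun v _ => (hbound _ _ _).1.le) trivial trivial
    have h0 : t0 ≤ s ε := ht0.2.trans (hu.2.trans hths)
    rw [hXt0, sub_zero, Real.norm_eq_abs, Real.norm_eq_abs, abs_of_nonneg (sub_nonneg.2 h0)] at h
    refine h.trans (mul_le_mul_of_nonneg_left ?_ hM.le)
    linarith [ht0.1]
  -- behaviour on [t, s]
  have hZnn : ∀ v ∈ Set.Icc t (s ε), 0 ≤ Z ε v := fun v hv =>
    htb.1.2 v (ht1.trans hv.1) hv.2
  have hd : ∀ c v, HasDerivAt (fun v => (Z ε v + X ε v + c) * Real.exp (-v / ε))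
      (((X ε v + |Z ε v|) / ε + f (X ε v) (Y ε v) (Z ε v)) * Real.exp (-v / ε)
        + (Z ε v + X ε v + c) * (Real.exp (-v / ε) * (-1 / ε))) v := fun c v =>
    (((dZ v).add (dX v)).add_const c).mul (((hasDerivAt_id v).neg.div_const ε).exp)
  have hd2 : ∀ c, ∀ v ∈ Set.Icc t (s ε),
      deriv (fun v => (Z ε v + X ε v + c * ε) * Real.exp (-v / ε)) v
        = (f (X ε v) (Y ε v) (Z ε v) - c) * Real.exp (-v / ε) := by
    intro c v hv
    rw [(hd (c * ε) v).deriv, abs_of_nonneg (hZnn v hv)]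
    field_simp
    ring
  have hanti : AntitoneOn (fun v => (Z ε v + X ε v + M * ε) * Real.exp (-v / ε))
      (Set.Icc t (s ε)) := by
    refine antitoneOn_of_deriv_nonpos (convex_Icc _ _)
      (fun v _ => (hd _ v).continuousAt.continuousWithinAt)
      (fun v _ => (hd _ v).differentiableAt.differentiableWithinAt) ?_
    intro v hv
    rw [hd2 M v (interior_subset hv)]
    have := (abs_lt.1 (hbound (X ε v) (Y ε v) (Z ε v)).1).2
    exact mul_nonpos_of_nonpos_of_nonneg (by linarith) (Real.exp_pos _).le
  have hmono : MonotoneOn (fun v => (Z ε v + X ε v + (-M) * ε) * Real.exp (-v / ε))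
      (Set.Icc t (s ε)) := by
    refine monotoneOn_of_deriv_nonneg (convex_Icc _ _)
      (fun v _ => (hd _ v).continuousAt.continuousWithinAt)
      (fun v _ => (hd _ v).differentiableAt.differentiableWithinAt) ?_
    intro v hv
    rw [hd2 (-M) v (interior_subset hv)]
    have := (abs_lt.1 (hbound (X ε v) (Y ε v) (Z ε v)).1).1
    exact mul_nonneg (by linarith) (Real.exp_pos _).le
  have h1 := hanti ⟨le_rfl, hts⟩ ⟨hts, le_rfl⟩ hts
  have h2 := hmono ⟨le_rfl, hts⟩ ⟨hts, le_rfl⟩ hts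
  simp only [hZs, zero_add] at h1 h2
  set E := Real.exp ((t - s ε) / ε) with hE
  have hEs : Real.exp (-(s ε) / ε) = E * Real.exp (-t / ε) := by
    rw [hE, ← Real.exp_add]
    congr 1
    ring
  have hEpos : 0 < E := Real.exp_pos _
  have hEle : E ≤ ε / T := by
    have : ε / T = Real.exp (-Real.log (T / ε)) := by
      rw [Real.exp_neg, Real.exp_log (by positivity), inv_div]
    rw [this, hE]
    apply Real.exp_le_exp.2
    rw [div_le_iff₀ hε]
    linarith
  rw [hEs, ← mul_assoc] at h1 h2
  have h1' := le_of_mul_le_mul_right h1 (Real.exp_pos _)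
  have h2' := le_of_mul_le_mul_right h2 (Real.exp_pos _)
  have hb : |X ε (s ε)| * E ≤ M * ε := by
    calc |X ε (s ε)| * E ≤ (M * T) * (ε / T) := by
          apply mul_le_mul hXs hEle hEpos.le (by positivity)
      _ = M * ε := by field_simp
  have hb1 : X ε (s ε) * E ≤ |X ε (s ε)| * E :=
    mul_le_mul_of_nonneg_right (le_abs_self _) hEpos.le
  have hb2 : -|X ε (s ε)| * E ≤ X ε (s ε) * E :=
    mul_le_mul_of_nonneg_right (neg_abs_le _) hEpos.le
  have hME : 0 < M * ε * E := by positivity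
  rw [abs_le]
  constructor <;> linarith
end
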